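/- Assume ζ_p ∈ K, let t ∈ I and set l = p·e_K/(p−1) − t. Then the extension L_t = K( (1 + c_y π^l)^{1/p} : y = 1,…,f_K ) is an elementary abelian p-extension of K of degree p^{f_K} with exactly one upper ramification jump, equal to t. -/

import Mathlib

noncomputable section

open scoped Classical

namespace PaperRam

/-- An additive `ℤ ∪ {∞}`-valued valuation on a field is *normalized* if it is
surjective onto `ℤ`. -/
def IsNormalized {F : Type*} [Field F] (v : AddValuation F (WithTop ℤ)) : Prop :=
  ∀ n : ℤ, ∃ x : F, v x = (n : WithTop ℤ)

/-- The normalized valuation `vF` of `F` extends the normalized valuation `vK` of `K`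
with ramification index `e`, i.e. `vF(x) = e · vK(x)` for all `x ∈ K`. -/
def Extends {K F : Type*} [Field K] [Field F] [Algebra K F]
    (vK : AddValuation K (WithTop ℤ)) (vF : AddValuation F (WithTop ℤ)) (e : ℕ) : Prop :=
  0 < e ∧ ∀ x : K, vF (algebraMap K F x) = e • vK x

/-- `v` is the normalized valuation of the `p`-adic field `K`, with (absolute)
ramification index `eK` over `ℚ_p`. -/
def IsPadicValuation (p : ℕ) [Fact p.Prime] {K : Type*} [Field K] [Algebra ℚ_[p] K]
    (v : AddValuation K (WithTop ℤ)) (eK : ℕ) : Prop :=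
  IsNormalized v ∧ 0 < eK ∧
    ∀ x : ℚ_[p], x ≠ 0 → v (algebraMap ℚ_[p] K x) = ((eK * x.valuation : ℤ) : WithTop ℤ)

/-- The valuation `v` of `F` is invariant under all `K`-algebra automorphisms of `F`. -/
def GalInvariant (K : Type*) {F : Type*} [Field K] [Field F] [Algebra K F]
    (v : AddValuation F (WithTop ℤ)) : Prop :=
  ∀ (σ : F ≃ₐ[K] F) (x : F), v (σ x) = v x

variable {K F : Type*} [Field K] [Field F] [Algebra K F]

/-- The lower-numbering ramification subgroup `G_i` of `Gal(F/K)`: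
`σ ∈ G_i ↔ v(σ x − x) ≥ i + 1` for all `x` in the valuation ring of `F`. -/
def lowerRG (v : AddValuation F (WithTop ℤ)) (hv : GalInvariant K v) (i : ℤ) :
    Subgroup (F ≃ₐ[K] F) where
  carrier := {σ | ∀ x : F, 0 ≤ v x → ((i + 1 : ℤ) : WithTop ℤ) ≤ v (σ x - x)}
  one_mem' := by
    intro x _
    simp
  mul_mem' := by
    intro a b ha hb x hx
    have h1 : ((i + 1 : ℤ) : WithTop ℤ) ≤ v (a (b x) - b x) :=
      ha (b x) (by rw [hv b x]; exact hx)
    have h2 := hb x hx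
    have hrw : (a * b) x - x = (a (b x) - b x) + (b x - x) := by
      rw [AlgEquiv.mul_apply]; ring
    rw [hrw]
    exact v.map_le_add h1 h2
  inv_mem' := by
    intro a ha x hx
    have hda : a (a⁻¹ x - x) = x - a x := by
      rw [map_sub]
      congr 1
      exact a.apply_symm_apply x
    have : v (a⁻¹ x - x) = v (a x - x) := by
      rw [← hv a (a⁻¹ x - x), hda, v.map_sub_swap]
    rw [this]
    exact ha x hx

/-- The Herbrand function `φ_{F/K}` evaluated at integers. -/
def herbrandPhi (v : AddValuation F (WithTop ℤ)) (hv : GalInvariant K v) (n : ℤ) : ℚ :=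
  if n ≤ 0 then (n : ℚ)
  else (∑ i ∈ Finset.Icc (1 : ℤ) n, (Nat.card (lowerRG v hv i) : ℚ)) /
    (Nat.card (lowerRG v hv 0) : ℚ)

/-- The upper-numbering ramification subgroup `G^u = G_{ψ(u)}` of `Gal(F/K)`. -/
def upperRG (v : AddValuation F (WithTop ℤ)) (hv : GalInvariant K v) (u : ℤ) :
    Subgroup (F ≃ₐ[K] F) :=
  lowerRG v hv (sInf {n : ℤ | (u : ℚ) ≤ herbrandPhi v hv n})

/-- `t` is an upper ramification jump of `F/K`: `G^u ≠ G^t` for every `u > t`. -/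
def IsUpperJump (v : AddValuation F (WithTop ℤ)) (hv : GalInvariant K v) (t : ℤ) : Prop :=
  ∀ u : ℤ, t < u → upperRG v hv u ≠ upperRG v hv t

/-- A group is elementary abelian of exponent `p` if it is isomorphic to `(ℤ/pℤ)^k`
for some `k`. -/
def IsElemAbelian (p : ℕ) (G : Type*) [Group G] : Prop :=
  ∃ k : ℕ, Nonempty (G ≃* (Fin k → Multiplicative (ZMod p)))

/-- The norm group `N_{L/K}(L^×)`, as a subgroup of `K^×`. -/
def normGroup (K L : Type*) [Field K] [Field L] [Algebra K L] : Subgroup Kˣ :=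
  (Units.map (Algebra.norm K : L →* K)).range

/-- The residues of `c 0, …, c (f-1)` lie in the valuation ring and form a basis of
the residue field of `v` over `𝔽_p`. -/
def IsResidueBasis (p : ℕ) {K : Type*} [Field K] (v : AddValuation K (WithTop ℤ))
    {f : ℕ} (c : Fin f → K) : Prop :=
  (∀ y, 0 ≤ v (c y)) ∧
  (∀ a : Fin f → ℤ, (1 : WithTop ℤ) ≤ v (∑ y, (a y : K) * c y) → ∀ y, (p : ℤ) ∣ a y) ∧
  (∀ x : K, 0 ≤ v x → ∃ a : Fin f → ℤ, (1 : WithTop ℤ) ≤ v (x - ∑ y, (a y : K) * c y))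

/-- `v_L(𝒟_{L/K})`: the valuation of the different of `L/K`, defined through the
inverse different `{x ∈ L ∣ Tr_{L/K}(x·𝒪_L) ⊆ 𝒪_K} = 𝔪_L^{-d}`. -/
def differentVal (K : Type*) {L : Type*} [Field K] [Field L] [Algebra K L]
    (vK : AddValuation K (WithTop ℤ)) (vL : AddValuation L (WithTop ℤ)) : ℤ :=
  sSup {m : ℤ | ∃ x : L, vL x = ((-m : ℤ) : WithTop ℤ) ∧
    ∀ y : L, 0 ≤ vL y → 0 ≤ vK (Algebra.trace K L (x * y))}

/-- The maximal elementary abelian `p`-extension `𝒞_K(p)` of `K` inside `Ω`: the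
compositum of all cyclic (equivalently, normal) extensions of `K` of degree `p`. -/
def maxElemAbelian (p : ℕ) (K Ω : Type*) [Field K] [Field Ω] [Algebra K Ω] :
    IntermediateField K Ω :=
  ⨆ L ∈ {L : IntermediateField K Ω | Module.finrank K L = p ∧ Normal K L}, L

/-- The subgroup `U_K^{i+1} = 1 + 𝔪_K^{i+1}` of principal units of `K^×`
(the index is shifted by one so that `principalUnits v 0 = U_K^1`). -/
def principalUnits {K : Type*} [Field K] (v : AddValuation K (WithTop ℤ)) (i : ℕ) :
    Subgroup Kˣ where
  carrier := {x : Kˣ | (((i : ℤ) + 1 : ℤ) : WithTop ℤ) ≤ v ((x : K) - 1)}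
  one_mem' := by simp
  mul_mem' := by
    intro a b ha hb
    have hpos : (0 : WithTop ℤ) < (((i : ℤ) + 1 : ℤ) : WithTop ℤ) := by
      rw [show (0 : WithTop ℤ) = ((0 : ℤ) : WithTop ℤ) from rfl]
      exact WithTop.coe_lt_coe.mpr (by omega)
    have hva : v (a : K) = 0 := by
      have h1 : v ((1 : K)) < v ((a : K) - 1) := by
        rw [v.map_one]; exact lt_of_lt_of_le hpos ha
      have h2 := v.map_add_eq_of_lt_right h1
      rw [sub_add_cancel] at h2
      rw [h2, v.map_one]
    have key : ((a * b : Kˣ) : K) - 1 = (a : K) * ((b : K) - 1) + ((a : K) - 1) := by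
      push_cast; ring
    show (((i : ℤ) + 1 : ℤ) : WithTop ℤ) ≤ v (((a * b : Kˣ) : K) - 1)
    rw [key]
    refine v.map_le_add ?_ ha
    rw [v.map_mul, hva, zero_add]
    exact hb
  inv_mem' := by
    intro a ha
    have hpos : (0 : WithTop ℤ) < (((i : ℤ) + 1 : ℤ) : WithTop ℤ) := by
      rw [show (0 : WithTop ℤ) = ((0 : ℤ) : WithTop ℤ) from rfl]
      exact WithTop.coe_lt_coe.mpr (by omega)
    have hva : v (a : K) = 0 := by
      have h1 : v ((1 : K)) < v ((a : K) - 1) := by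
        rw [v.map_one]; exact lt_of_lt_of_le hpos ha
      have h2 := v.map_add_eq_of_lt_right h1
      rw [sub_add_cancel] at h2
      rw [h2, v.map_one]
    have key : ((a⁻¹ : Kˣ) : K) - 1 = ((a : K))⁻¹ * (1 - (a : K)) := by
      rw [mul_sub, mul_one, inv_mul_cancel₀ (Units.ne_zero a)]
      push_cast
      ring
    show (((i : ℤ) + 1 : ℤ) : WithTop ℤ) ≤ v (((a⁻¹ : Kˣ) : K) - 1)
    rw [key, v.map_mul, v.map_inv, hva, v.map_sub_swap]
    simpa using ha

section Valuation

variable (v : AddValuation F (WithTop ℤ))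

theorem exists_map_eq_coe {x : F} (hx : x ≠ 0) : ∃ n : ℤ, v x = n := by
  obtain ⟨n, hn⟩ := WithTop.ne_top_iff_exists.1 (v.ne_top_iff.2 hx)
  exact ⟨n, hn.symm⟩

theorem nsmul_coe (e : ℕ) (n : ℤ) : e • (n : WithTop ℤ) = ((e * n : ℤ) : WithTop ℤ) := by
  rw [← WithTop.coe_nsmul, nsmul_eq_mul]

theorem coe_add_le_map_mul {m n : ℤ} {x y : F} (hx : (m : WithTop ℤ) ≤ v x)
    (hy : (n : WithTop ℤ) ≤ v y) : ((m + n : ℤ) : WithTop ℤ) ≤ v (x * y) := by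
  rw [v.map_mul, WithTop.coe_add]
  exact add_le_add hx hy

theorem coe_le_map_mul_left {n : ℤ} {x y : F} (hx : 0 ≤ v x)
    (hy : (n : WithTop ℤ) ≤ v y) : (n : WithTop ℤ) ≤ v (x * y) := by
  rw [v.map_mul]
  simpa using add_le_add hx hy

theorem coe_le_map_mul_right {n : ℤ} {x y : F} (hx : (n : WithTop ℤ) ≤ v x)
    (hy : 0 ≤ v y) : (n : WithTop ℤ) ≤ v (x * y) := by
  rw [mul_comm]
  exact coe_le_map_mul_left v hy hx

theorem map_mul_nonneg {x y : F} (hx : 0 ≤ v x) (hy : 0 ≤ v y) : 0 ≤ v (x * y) := by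
  rw [v.map_mul]
  exact add_nonneg hx hy

theorem map_pow_nonneg {x : F} (hx : 0 ≤ v x) (n : ℕ) : 0 ≤ v (x ^ n) := by
  rw [v.map_pow]
  exact nsmul_nonneg hx n

theorem map_pow_eq_coe {x : F} {m : ℤ} (hx : v x = m) (n : ℕ) :
    v (x ^ n) = ((n * m : ℤ) : WithTop ℤ) := by
  rw [v.map_pow, hx, nsmul_coe]

theorem map_zpow_eq_coe {x : F} {m : ℤ} (hx : v x = m) (n : ℤ) :
    v (x ^ n) = ((n * m : ℤ) : WithTop ℤ) := by
  have hx0 : x ≠ 0 := v.ne_top_iff.1 (by simp [hx])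
  obtain ⟨k, rfl | rfl⟩ := n.eq_nat_or_neg
  · rw [zpow_natCast, map_pow_eq_coe v hx]
  · obtain ⟨r, hr⟩ := exists_map_eq_coe v (zpow_ne_zero (-(k : ℤ)) hx0)
    have h := v.map_mul (x ^ (-(k : ℤ))) (x ^ k)
    rw [zpow_neg, zpow_natCast, inv_mul_cancel₀ (pow_ne_zero _ hx0), ← zpow_natCast, ← zpow_neg,
      hr, zpow_natCast, map_pow_eq_coe v hx, v.map_one] at h
    rw [hr]
    norm_cast at h ⊢
    linarith

theorem nonneg_of_map_pow_nonneg {x : F} {n : ℕ} (hn : n ≠ 0) (h : 0 ≤ v (x ^ n)) :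
    0 ≤ v x := by
  by_cases hx : x = 0
  · simp [hx]
  obtain ⟨m, hm⟩ := exists_map_eq_coe v hx
  rw [map_pow_eq_coe v hm] at h
  rw [hm]
  norm_cast at h ⊢
  exact nonneg_of_mul_nonneg_right h (by positivity)

theorem map_prod_le_card_mul {ι : Type*} (s : Finset ι) (f : ι → F) {m : ℤ}
    (h : ∀ i ∈ s, v (f i) ≤ m) : v (∏ i ∈ s, f i) ≤ ((s.card * m : ℤ) : WithTop ℤ) := by
  induction s using Finset.induction_on with
  | empty => simp
  | insert a s ha ih =>
    rw [Finset.prod_insert ha, v.map_mul, Finset.card_insert_of_notMem ha]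
    refine (add_le_add (h a (Finset.mem_insert_self _ _))
      (ih fun i hi => h i (Finset.mem_insert_of_mem hi))).trans (le_of_eq ?_)
    rw [← WithTop.coe_add]
    congr 1
    push_cast
    ring

theorem card_mul_le_map_prod {ι : Type*} (s : Finset ι) (f : ι → F) {m : ℤ}
    (h : ∀ i ∈ s, (m : WithTop ℤ) ≤ v (f i)) :
    ((s.card * m : ℤ) : WithTop ℤ) ≤ v (∏ i ∈ s, f i) := by
  induction s using Finset.induction_on with
  | empty => simp
  | insert a s ha ih =>
    rw [Finset.prod_insert ha, Finset.card_insert_of_notMem ha]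
    have := coe_add_le_map_mul v (h a (Finset.mem_insert_self _ _))
      (ih fun i hi => h i (Finset.mem_insert_of_mem hi))
    convert this using 1
    norm_cast
    push_cast
    ring

/-- If the nonzero terms of a finite sum have pairwise distinct valuations, the sum has at most
the valuation of each term. -/
theorem map_sum_le_of_distinct {ι : Type*} (s : Finset ι) (f : ι → F)
    (h : ∀ i ∈ s, ∀ j ∈ s, f i ≠ 0 → f j ≠ 0 → v (f i) = v (f j) → i = j) {i : ι} (hi : i ∈ s) :
    v (∑ j ∈ s, f j) ≤ v (f i) := by
  obtain ⟨a, ha, hmin⟩ := s.exists_min_image (fun j => v (f j)) ⟨i, hi⟩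
  by_cases hfa : f a = 0
  · have : ∀ j ∈ s, f j = 0 := fun j hj => by
      have := hmin j hj
      rw [hfa, v.map_zero, top_le_iff] at this
      exact v.top_iff.1 this
    simp [this i hi]
  · refine le_trans (le_of_eq ?_) (hmin i hi)
    rw [← Finset.add_sum_erase s f ha]
    refine v.map_add_eq_of_lt_left ?_
    refine v.map_lt_sum (v.ne_top_iff.2 hfa) fun j hj => ?_
    obtain ⟨hja, hjs⟩ := Finset.mem_erase.1 hj
    refine lt_of_le_of_ne (hmin j hjs) fun he => hja ?_
    have hfj : f j ≠ 0 := fun h0 => by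
      rw [h0, v.map_zero] at he
      exact hfa (v.top_iff.1 he)
    exact (h a ha j hjs hfa hfj he).symm

theorem map_natCast_nonneg (n : ℕ) : 0 ≤ v (n : F) := by
  induction n with
  | zero => simp
  | succ n ih =>
    rw [Nat.cast_succ]
    exact v.map_le_add ih (by simp)

theorem map_intCast_nonneg (n : ℤ) : 0 ≤ v (n : F) := by
  obtain ⟨k, rfl | rfl⟩ := n.eq_nat_or_neg
  · simpa using map_natCast_nonneg v k
  · simpa using map_natCast_nonneg v k

theorem le_map_pow_sub_one {a : F} {m : ℤ} (ha : 0 ≤ v a) (h : (m : WithTop ℤ) ≤ v (a - 1))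
    (n : ℕ) : (m : WithTop ℤ) ≤ v (a ^ n - 1) := by
  rw [← geom_sum_mul]
  exact coe_le_map_mul_left v (v.map_le_sum fun i _ => map_pow_nonneg v ha i) h

theorem map_pow_sub_one_eq {a : F} (ha : 0 ≤ v a) (h : (1 : WithTop ℤ) ≤ v (a - 1)) {n : ℕ}
    (hn : v (n : F) = 0) : v (a ^ n - 1) = v (a - 1) := by
  rw [← geom_sum_mul, v.map_mul]
  have hs : ∑ i ∈ Finset.range n, a ^ i = n + ∑ i ∈ Finset.range n, (a ^ i - 1) := by
    simp
  have : v (∑ i ∈ Finset.range n, a ^ i) = 0 := by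
    rw [hs, v.map_add_eq_of_lt_left, hn]
    rw [hn]
    refine lt_of_lt_of_le zero_lt_one (v.map_le_sum fun i _ => ?_)
    exact_mod_cast le_map_pow_sub_one v ha (m := 1) (by exact_mod_cast h) i
  rw [this, zero_add]

/-- For `a ^ p` close to `1`, but not too close, the valuation of `a - 1` is `1 / p` of that of
`a ^ p - 1`. -/
theorem exists_map_sub_one_eq_of_pow {p : ℕ} (hp : p.Prime) {E D : ℤ}
    (hE : v (p : F) = E) (hD : 0 < D) (hDE : (p - 1) * D < p * E) {a : F}
    (ha : v (a ^ p - 1) = D) : ∃ b : ℤ, v (a - 1) = b ∧ p * b = D := by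
  have hp1 : (1 : ℤ) < p := by exact_mod_cast hp.one_lt
  have hint : 0 ≤ v a := by
    refine nonneg_of_map_pow_nonneg v hp.ne_zero ?_
    have : (a ^ p - 1) + 1 = a ^ p := by ring
    rw [← this]
    refine v.map_le_add ?_ (by simp)
    rw [ha]
    exact_mod_cast hD.le
  obtain ⟨x, rfl⟩ : ∃ x, a = x + 1 := ⟨a - 1, by ring⟩
  have hx : 0 ≤ v x := by
    have : x = (x + 1) - 1 := by ring
    rw [this]
    exact v.map_le_sub hint (by simp)
  have hx0 : x ≠ 0 := by
    rintro rfl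
    simp at ha
  obtain ⟨b, hb⟩ := exists_map_eq_coe v hx0
  rw [hb] at hx
  have hb0 : 0 ≤ b := by exact_mod_cast hx
  refine ⟨b, by simpa using hb, ?_⟩
  have hexp := add_pow_prime_eq hp x (1 : F)
  set r := ∑ k ∈ Finset.Ioo 0 p, x ^ (k - 1) * 1 ^ (p - k - 1) * ((p.choose k / p : ℕ) : F)
    with hr
  have hrv : 0 ≤ v r := v.map_le_sum fun k _ => map_mul_nonneg v
    (map_mul_nonneg v (map_pow_nonneg v (by simpa [hb] using hb0) _) (by simp))
    (map_natCast_nonneg v _)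
  have heq : (x + 1) ^ p - 1 = x ^ p + (p : F) * x * r := by
    rw [hexp]
    ring
  have h2 : ((E + b : ℤ) : WithTop ℤ) ≤ v ((p : F) * x * r) :=
    coe_le_map_mul_right v (coe_add_le_map_mul v hE.ge hb.ge) hrv
  have h1 := map_pow_eq_coe v hb p
  rw [heq] at ha
  by_cases hlt : (p : ℤ) * b < E + b
  · rw [v.map_add_eq_of_lt_left, h1] at ha
    · exact_mod_cast ha
    · rw [h1]
      exact lt_of_lt_of_le (by exact_mod_cast hlt) h2
  · exfalso
    push Not at hlt
    have h3 : ((E + b : ℤ) : WithTop ℤ) ≤ D := by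
      rw [← ha]
      refine v.map_le_add ?_ h2
      rw [h1]
      exact_mod_cast hlt
    have h4 : E + b ≤ D := by exact_mod_cast h3
    nlinarith

/-- Congruences between `p`-power powers descend to the base. -/
theorem one_le_map_sub_of_pow {p : ℕ} (hp : p.Prime) (hpv : (1 : WithTop ℤ) ≤ v (p : F)) (n : ℕ)
    {x y : F} (hx : 0 ≤ v x) (hy : 0 ≤ v y) (h : (1 : WithTop ℤ) ≤ v (x ^ p ^ n - y ^ p ^ n)) :
    (1 : WithTop ℤ) ≤ v (x - y) := by
  have key : ∀ {x y : F}, 0 ≤ v x → 0 ≤ v y → (1 : WithTop ℤ) ≤ v (x ^ p - y ^ p) →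
      (1 : WithTop ℤ) ≤ v (x - y) := by
    intro x y hx hy h
    have hexp := add_pow_prime_eq hp (x - y) y
    set r := ∑ k ∈ Finset.Ioo 0 p, (x - y) ^ (k - 1) * y ^ (p - k - 1) *
      ((p.choose k / p : ℕ) : F) with hr
    have hxy : 0 ≤ v (x - y) := v.map_le_sub hx hy
    have hrv : 0 ≤ v r := v.map_le_sum fun k _ => map_mul_nonneg v
      (map_mul_nonneg v (map_pow_nonneg v hxy _) (map_pow_nonneg v hy _))
      (map_natCast_nonneg v _)
    have heq : (x - y) ^ p = (x ^ p - y ^ p) - (p : F) * ((x - y) * y * r) := by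
      rw [sub_add_cancel] at hexp
      rw [hexp]
      ring
    have h1 : (1 : WithTop ℤ) ≤ v ((x - y) ^ p) := by
      rw [heq]
      refine v.map_le_sub h ?_
      have := coe_le_map_mul_right v (n := 1) (by exact_mod_cast hpv)
        (map_mul_nonneg v (map_mul_nonneg v hxy hy) hrv)
      exact_mod_cast this
    by_cases h0 : x - y = 0
    · simp [h0]
    obtain ⟨m, hm⟩ := exists_map_eq_coe v h0
    rw [map_pow_eq_coe v hm] at h1
    rw [hm]
    norm_cast at h1 ⊢
    by_contra hm'
    have : m ≤ 0 := by lia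
    nlinarith [hp.pos]
  induction n with
  | zero => simpa using h
  | succ n ih =>
    rw [pow_succ, pow_mul, pow_mul] at h
    exact ih (key (map_pow_nonneg v hx _) (map_pow_nonneg v hy _) h)

end Valuation

section BaseField

variable (v : AddValuation F (WithTop ℤ)) {p : ℕ}

theorem one_le_map_of_pos {x : F} (h : 0 < v x) : (1 : WithTop ℤ) ≤ v x := by
  by_cases h0 : x = 0
  · simp [h0]
  obtain ⟨m, hm⟩ := exists_map_eq_coe v h0
  rw [hm] at h ⊢
  norm_cast at h ⊢

theorem map_natCast_eq_zero (hp : p.Prime) (hpv : (1 : WithTop ℤ) ≤ v (p : F)) {n : ℕ}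
    (hn : ¬ p ∣ n) : v (n : F) = 0 := by
  refine le_antisymm ?_ (map_natCast_nonneg v n)
  by_contra h
  push Not at h
  have h1 := one_le_map_of_pos v h
  have hco : IsCoprime (n : ℤ) p :=
    Nat.isCoprime_iff_coprime.2 ((Nat.Prime.coprime_iff_not_dvd hp).2 hn).symm
  obtain ⟨a, b, hab⟩ := hco
  have h2 : (a : F) * n + b * p = 1 := by exact_mod_cast congrArg (Int.cast : ℤ → F) hab
  have h3 : ((1 : ℤ) : WithTop ℤ) ≤ v ((a : F) * n + b * p) := v.map_le_add
    (coe_le_map_mul_left v (map_intCast_nonneg v a) (by exact_mod_cast h1))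
    (coe_le_map_mul_left v (map_intCast_nonneg v b) (by exact_mod_cast hpv))
  rw [h2, v.map_one] at h3
  norm_cast at h3

/-- The valuation of `ζ ^ k - 1` for a primitive `p`-th root of unity `ζ`. -/
theorem map_pow_sub_one_of_isPrimitiveRoot (hp : p.Prime) {E : ℤ} (hE : v (p : F) = E) {ζ : F}
    (hζ : IsPrimitiveRoot ζ p) :
    ∃ w : ℤ, (p - 1) * w = E ∧ ∀ k : ℕ, ¬ p ∣ k → v (ζ ^ k - 1) = w := by
  have hζv : 0 ≤ v ζ := nonneg_of_map_pow_nonneg v hp.ne_zero (by simp [hζ.pow_eq_one])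
  obtain ⟨w, hw⟩ := exists_map_eq_coe v (sub_ne_zero.2 (hζ.ne_one hp.one_lt))
  have hall : ∀ k : ℕ, ¬ p ∣ k → v (ζ ^ k - 1) = w := by
    intro k hk
    refine le_antisymm ?_ (le_map_pow_sub_one v hζv hw.ge k)
    have hprim : IsPrimitiveRoot (ζ ^ k) p :=
      hζ.pow_of_coprime k ((Nat.Prime.coprime_iff_not_dvd hp).2 hk).symm
    have : NeZero p := ⟨hp.ne_zero⟩
    obtain ⟨i, -, hi⟩ := hprim.eq_pow_of_pow_eq_one hζ.pow_eq_one
    obtain ⟨u, hu⟩ := exists_map_eq_coe v (sub_ne_zero.2 (hprim.ne_one hp.one_lt))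
    have := le_map_pow_sub_one v (map_pow_nonneg v hζv k) hu.ge i
    rw [hi, hw] at this
    rw [hu]
    exact this
  refine ⟨w, ?_, hall⟩
  obtain ⟨n, rfl⟩ : ∃ n, p = n + 1 := ⟨p - 1, (Nat.succ_pred_prime hp).symm⟩
  have hprod := hζ.prod_one_sub_pow_eq_order
  have hval : ∀ k ∈ Finset.range n, v (1 - ζ ^ (k + 1)) = w := fun k hk => by
    rw [v.map_sub_swap]
    refine hall _ fun hd => ?_
    have := Nat.le_of_dvd k.succ_pos hd
    have := Finset.mem_range.1 hk
    lia
  have h1 := map_prod_le_card_mul v _ _ fun k hk => (hval k hk).le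
  have h2 := card_mul_le_map_prod v _ _ fun k hk => (hval k hk).ge
  have h3 := le_antisymm h1 h2
  rw [hprod] at h3
  push_cast at hE
  rw [hE, Finset.card_range] at h3
  have : E = n * w := by exact_mod_cast h3
  push_cast
  linarith

theorem one_le_map_sum_sub {f : ℕ} {c : Fin f → F} (hc : ∀ y, 0 ≤ v (c y))
    (hpv : (1 : WithTop ℤ) ≤ v (p : F)) {a b : Fin f → ℤ} (h : ∀ y, (p : ℤ) ∣ a y - b y) :
    (1 : WithTop ℤ) ≤ v (∑ y, (a y : F) * c y - ∑ y, (b y : F) * c y) := by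
  rw [← Finset.sum_sub_distrib]
  refine v.map_le_sum fun y _ => ?_
  obtain ⟨d, hd⟩ := h y
  have : (a y : F) * c y - b y * c y = (p : F) * (d * c y) := by
    rw [← sub_mul, ← Int.cast_sub, hd]
    push_cast
    ring
  rw [this]
  exact_mod_cast coe_le_map_mul_right v (n := 1) (by exact_mod_cast hpv)
    (map_mul_nonneg v (map_intCast_nonneg v d) (hc y))

/-- The residue field is perfect: every integer is congruent to a `p ^ n`-th power. -/
theorem exists_one_le_map_sub_pow (hp : p.Prime) (hpv : (1 : WithTop ℤ) ≤ v (p : F)) {f : ℕ}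
    {c : Fin f → F} (hc : IsResidueBasis p v c) (n : ℕ) {x : F} (hx : 0 ≤ v x) :
    ∃ k : F, 0 ≤ v k ∧ (1 : WithTop ℤ) ≤ v (x - k ^ p ^ n) := by
  have : NeZero p := ⟨hp.ne_zero⟩
  set C : (Fin f → ZMod p) → F := fun s => ∑ y, (((s y).val : ℤ) : F) * c y with hC
  have hCv : ∀ s, 0 ≤ v (C s) := fun s => v.map_le_sum fun y _ =>
    map_mul_nonneg v (map_intCast_nonneg v _) (hc.1 y)
  choose g hg using fun s => hc.2.2 (C s ^ p ^ n) (map_pow_nonneg v (hCv s) _)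
  have hinj : Function.Injective fun s y => ((g s y : ℤ) : ZMod p) := by
    intro s s' h
    have hdvd : ∀ y, (p : ℤ) ∣ g s y - g s' y := fun y => by
      have := congrFun h y
      rwa [eq_comm, ZMod.intCast_eq_intCast_iff_dvd_sub] at this
    have h1 : (1 : WithTop ℤ) ≤ v (C s ^ p ^ n - C s' ^ p ^ n) := by
      have : C s ^ p ^ n - C s' ^ p ^ n = (C s ^ p ^ n - ∑ y, (g s y : F) * c y) +
        (∑ y, (g s y : F) * c y - ∑ y, (g s' y : F) * c y) -
        (C s' ^ p ^ n - ∑ y, (g s' y : F) * c y) := by ring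
      rw [this]
      exact v.map_le_sub (v.map_le_add (hg s) (one_le_map_sum_sub v hc.1 hpv hdvd)) (hg s')
    have h2 := one_le_map_sub_of_pow v hp hpv n (hCv s) (hCv s') h1
    have h3 := hc.2.1 (fun y => ((s y).val : ℤ) - ((s' y).val : ℤ)) (by
      convert h2 using 2
      rw [hC, ← Finset.sum_sub_distrib]
      refine Finset.sum_congr rfl fun y _ => ?_
      push_cast
      ring)
    funext y
    have h4 := (ZMod.intCast_zmod_eq_zero_iff_dvd _ _).2 (h3 y)
    push_cast at h4
    simpa [sub_eq_zero] using h4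
  obtain ⟨a, ha⟩ := hc.2.2 x hx
  obtain ⟨s, hs⟩ := Finite.surjective_of_injective hinj fun y => ((a y : ℤ) : ZMod p)
  refine ⟨C s, hCv s, ?_⟩
  have hdvd : ∀ y, (p : ℤ) ∣ a y - g s y := fun y => by
    have := congrFun hs y
    rwa [ZMod.intCast_eq_intCast_iff_dvd_sub] at this
  have : x - C s ^ p ^ n = (x - ∑ y, (a y : F) * c y) +
    (∑ y, (a y : F) * c y - ∑ y, (g s y : F) * c y) -
    (C s ^ p ^ n - ∑ y, (g s y : F) * c y) := by ring
  rw [this]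
  exact v.map_le_sub (v.map_le_add ha (one_le_map_sum_sub v hc.1 hpv hdvd)) (hg s)

theorem le_map_mul_sub_one_sub {l : ℤ} (hl : 0 ≤ l) {A A' S S' : F}
    (hS : (l : WithTop ℤ) ≤ v S) (hS' : (l : WithTop ℤ) ≤ v S')
    (hA : ((2 * l : ℤ) : WithTop ℤ) ≤ v (A - 1 - S))
    (hA' : ((2 * l : ℤ) : WithTop ℤ) ≤ v (A' - 1 - S')) :
    ((2 * l : ℤ) : WithTop ℤ) ≤ v (A * A' - 1 - (S + S')) := by
  have h0 : ∀ {x : F} {m : ℤ}, 0 ≤ m → (m : WithTop ℤ) ≤ v x → 0 ≤ v x :=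
    fun hm h => le_trans (by exact_mod_cast hm) h
  have hA0 : 0 ≤ v A' := by
    have : A' = (A' - 1 - S') + (1 + S') := by ring
    rw [this]
    exact v.map_le_add (h0 (by lia) hA') (v.map_le_add (by simp) (h0 hl hS'))
  have : A * A' - 1 - (S + S') = (A - 1 - S) * A' + (1 + S) * (A' - 1 - S') + S * S' := by ring
  rw [this]
  refine v.map_le_add (v.map_le_add (coe_le_map_mul_right v hA hA0)
    (coe_le_map_mul_left v (v.map_le_add (by simp) (h0 hl hS)) hA')) ?_
  have := coe_add_le_map_mul v hS hS'
  rwa [← two_mul] at this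

theorem le_map_prod_pow_sub_one_sub {ι : Type*} (s : Finset ι) {l : ℤ} (hl : 0 ≤ l) {x : ι → F}
    (hx : ∀ i, (l : WithTop ℤ) ≤ v (x i)) (n : ι → ℕ) :
    ((2 * l : ℤ) : WithTop ℤ) ≤ v (∏ i ∈ s, (1 + x i) ^ n i - 1 - ∑ i ∈ s, (n i : F) * x i) := by
  have hnx : ∀ i (m : ℕ), (l : WithTop ℤ) ≤ v ((m : F) * x i) := fun i m =>
    coe_le_map_mul_left v (map_natCast_nonneg v m) (hx i)
  have hpow : ∀ i (m : ℕ), ((2 * l : ℤ) : WithTop ℤ) ≤ v ((1 + x i) ^ m - 1 - (m : F) * x i) := by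
    intro i m
    induction m with
    | zero => simp
    | succ m ih =>
      have := le_map_mul_sub_one_sub v hl (hnx i m) (hx i) ih (A' := 1 + x i) (by simp)
      convert this using 2
      push_cast
      ring
  induction s using Finset.induction_on with
  | empty => simp
  | insert a s ha ih =>
    rw [Finset.prod_insert ha, Finset.sum_insert ha]
    exact le_map_mul_sub_one_sub v hl (hnx a _) (v.map_le_sum fun i _ => hnx i _) (hpow a _) ih

/-- A nontrivial product of the `1 + c_y π ^ l` differs from `1` by an element of
valuation exactly `l`. -/
theorem map_prod_one_add_sub_one [NeZero p] {f : ℕ} {c : Fin f → F} (hc : IsResidueBasis p v c)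
    {π : F} (hπ : v π = ((1 : ℤ) : WithTop ℤ)) {l : ℕ} (hl : 1 ≤ l) {a : Fin f → ZMod p}
    (ha : a ≠ 0) : v (∏ y, (1 + c y * π ^ l) ^ (a y).val - 1) = ((l : ℤ) : WithTop ℤ) := by
  have hπl : v (π ^ l) = ((l : ℤ) : WithTop ℤ) := by simpa using map_pow_eq_coe v hπ l
  have hS : v (∑ y, ((a y).val : F) * (c y * π ^ l)) = ((l : ℤ) : WithTop ℤ) := by
    have h0 : v (∑ y, ((a y).val : F) * c y) = 0 := by
      refine le_antisymm ?_ (v.map_le_sum fun y _ =>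
        map_mul_nonneg v (map_natCast_nonneg v _) (hc.1 y))
      by_contra h
      push Not at h
      refine ha (funext fun y => ?_)
      have h1 := hc.2.1 (fun y => ((a y).val : ℤ)) (by
        simpa only [Int.cast_natCast] using one_le_map_of_pos v h) y
      have h2 := (ZMod.intCast_zmod_eq_zero_iff_dvd _ _).2 h1
      simpa using h2
    simp_rw [← mul_assoc]
    rw [← Finset.sum_mul, v.map_mul, h0, hπl, zero_add]
  have h := le_map_prod_pow_sub_one_sub v Finset.univ (l := l) (by positivity)
    (x := fun y => c y * π ^ l) (fun y => coe_le_map_mul_left v (hc.1 y) hπl.ge)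
    (fun y => (a y).val)
  rw [← hS]
  refine v.map_eq_of_lt_sub ?_
  rw [hS]
  refine lt_of_lt_of_le ?_ h
  exact_mod_cast (by lia : (l : ℤ) < 2 * l)

end BaseField

section Extension

theorem fin_eq_of_dvd_sub {n : ℕ} {i j : Fin n} (h : (n : ℤ) ∣ ((i : ℕ) : ℤ) - ((j : ℕ) : ℤ)) :
    i = j := by
  have h1 : ((i : ℕ) : ℤ) % n = ((j : ℕ) : ℤ) % n := Int.ModEq.symm ((Int.modEq_iff_dvd).2 h)
  rw [Int.emod_eq_of_lt (by positivity) (by exact_mod_cast i.2),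
    Int.emod_eq_of_lt (by positivity) (by exact_mod_cast j.2)] at h1
  exact Fin.ext (by exact_mod_cast h1)

variable {vK : AddValuation K (WithTop ℤ)} {vF : AddValuation F (WithTop ℤ)} {e : ℕ}

theorem Extends.map_algebraMap_eq_coe (hext : Extends vK vF e) {x : K} {m : ℤ} (hx : vK x = m) :
    vF (algebraMap K F x) = ((e * m : ℤ) : WithTop ℤ) := by
  rw [hext.2, hx, nsmul_coe]

theorem Extends.map_algebraMap_nonneg_iff (hext : Extends vK vF e) {x : K} :
    0 ≤ vF (algebraMap K F x) ↔ 0 ≤ vK x := by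
  by_cases hx : x = 0
  · simp [hx]
  obtain ⟨m, hm⟩ := exists_map_eq_coe vK hx
  rw [hext.map_algebraMap_eq_coe hm, hm]
  norm_cast
  have := hext.1
  exact ⟨fun h => nonneg_of_mul_nonneg_right h (by exact_mod_cast this), fun h => by positivity⟩

theorem Extends.one_le_map_algebraMap (hext : Extends vK vF e) {x : K}
    (hx : (1 : WithTop ℤ) ≤ vK x) : (1 : WithTop ℤ) ≤ vF (algebraMap K F x) := by
  by_cases hx0 : x = 0
  · simp [hx0]
  obtain ⟨m, hm⟩ := exists_map_eq_coe vK hx0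
  rw [hm] at hx
  rw [hext.map_algebraMap_eq_coe hm]
  have := hext.1
  norm_cast at hx ⊢
  nlinarith

theorem Extends.exists_map_smul_eq (hext : Extends vK vF e) {k : K} (hk : k ≠ 0) {x : F} {r : ℤ}
    (hx : vF x = r) : ∃ m : ℤ, vK k = m ∧ vF (k • x) = ((e * m + r : ℤ) : WithTop ℤ) := by
  obtain ⟨m, hm⟩ := exists_map_eq_coe vK hk
  refine ⟨m, hm, ?_⟩
  rw [Algebra.smul_def, vF.map_mul, hext.map_algebraMap_eq_coe hm, hx, ← WithTop.coe_add]

/-- For elements with valuations distinct modulo `e`, a `K`-linear combination has at most the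
valuation of each of its terms. -/
theorem Extends.map_sum_smul_le (hext : Extends vK vF e) {ι : Type*} (s : Finset ι) {x : ι → F}
    {r : ι → ℤ} (hx : ∀ i, vF (x i) = r i) (hr : ∀ i j, (e : ℤ) ∣ r i - r j → i = j) (k : ι → K)
    {i : ι} (hi : i ∈ s) : vF (∑ j ∈ s, k j • x j) ≤ vF (k i • x i) := by
  refine map_sum_le_of_distinct vF s _ (fun i _ j _ hi hj h => hr i j ?_) hi
  obtain ⟨m, -, hm⟩ := hext.exists_map_smul_eq (left_ne_zero_of_smul hi) (hx i)
  obtain ⟨n, -, hn⟩ := hext.exists_map_smul_eq (left_ne_zero_of_smul hj) (hx j)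
  rw [hm, hn] at h
  norm_cast at h
  exact ⟨n - m, by linarith⟩

theorem Extends.linearIndependent (hext : Extends vK vF e) {ι : Type*} {x : ι → F}
    {r : ι → ℤ} (hx : ∀ i, vF (x i) = r i) (hr : ∀ i j, (e : ℤ) ∣ r i - r j → i = j) :
    LinearIndependent K x := by
  rw [linearIndependent_iff']
  intro s g hg i hi
  have h := hext.map_sum_smul_le s hx hr g hi
  rw [hg, vF.map_zero, top_le_iff, vF.top_iff] at h
  refine (smul_eq_zero.1 h).resolve_right (vF.ne_top_iff.1 ?_)
  simp [hx]

theorem Extends.linearIndependent_pow (hext : Extends vK vF e) {ϖ : F}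
    (hϖ : vF ϖ = ((1 : ℤ) : WithTop ℤ)) : LinearIndependent K fun i : Fin e => ϖ ^ (i : ℕ) := by
  refine hext.linearIndependent (r := fun i => (i : ℕ)) (fun i => ?_) fun i j h => ?_
  · simpa using map_pow_eq_coe vF hϖ i
  · exact fin_eq_of_dvd_sub h

theorem one_le_map_prod_sub_pow {ι : Type*} (s : Finset ι) {y : ι → F} {x : F} (hx : 0 ≤ vF x)
    (hy : ∀ i, (1 : WithTop ℤ) ≤ vF (y i - x)) :
    (1 : WithTop ℤ) ≤ vF (∏ i ∈ s, y i - x ^ s.card) := by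
  induction s using Finset.induction_on with
  | empty => simp
  | insert a s ha ih =>
    rw [Finset.prod_insert ha, Finset.card_insert_of_notMem ha]
    have hya : 0 ≤ vF (y a) := by
      rw [← sub_add_cancel (y a) x]
      exact vF.map_le_add (zero_le_one.trans (hy a)) hx
    have : y a * ∏ i ∈ s, y i - x ^ (s.card + 1) =
      y a * (∏ i ∈ s, y i - x ^ s.card) + (y a - x) * x ^ s.card := by ring
    rw [this]
    refine vF.map_le_add ?_ ?_
    · exact_mod_cast coe_le_map_mul_left vF (n := 1) hya (by exact_mod_cast ih)
    · exact_mod_cast coe_le_map_mul_right vF (n := 1) (by exact_mod_cast hy a)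
        (map_pow_nonneg vF hx _)

/-- If the Galois group acts trivially on the residue field and has `p`-power order, the residue
field extension is trivial. -/
theorem Extends.exists_one_le_map_sub (hext : Extends vK vF e) [FiniteDimensional K F]
    [IsGalois K F] {p : ℕ} (hp : p.Prime) (hpv : (1 : WithTop ℤ) ≤ vK (p : K)) {f : ℕ}
    {c : Fin f → K} (hc : IsResidueBasis p vK c) {n : ℕ} (hn : Module.finrank K F = p ^ n)
    (hG : ∀ (σ : F ≃ₐ[K] F) (x : F), 0 ≤ vF x → (1 : WithTop ℤ) ≤ vF (σ x - x)) {x : F}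
    (hx : 0 ≤ vF x) : ∃ k : K, 0 ≤ vK k ∧ (1 : WithTop ℤ) ≤ vF (x - algebraMap K F k) := by
  have h1 := one_le_map_prod_sub_pow (vF := vF) Finset.univ (y := fun σ : F ≃ₐ[K] F => σ x) hx
    fun σ => hG σ x hx
  rw [← Algebra.norm_eq_prod_automorphisms, Finset.card_univ, ← Nat.card_eq_fintype_card,
    IsGalois.card_aut_eq_finrank, hn] at h1
  have hN : 0 ≤ vK (Algebra.norm K x) := by
    rw [← hext.map_algebraMap_nonneg_iff, ← sub_add_cancel (algebraMap K F _) (x ^ p ^ n)]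
    exact vF.map_le_add (zero_le_one.trans h1) (map_pow_nonneg vF hx _)
  obtain ⟨k, hk, hk1⟩ := exists_one_le_map_sub_pow vK hp hpv hc n hN
  refine ⟨k, hk, ?_⟩
  have hpF : (1 : WithTop ℤ) ≤ vF (p : F) := by simpa using hext.one_le_map_algebraMap hpv
  refine one_le_map_sub_of_pow vF hp hpF n hx (hext.map_algebraMap_nonneg_iff.2 hk) ?_
  have h2 := hext.one_le_map_algebraMap hk1
  have : x ^ p ^ n - algebraMap K F k ^ p ^ n =
    algebraMap K F (Algebra.norm K x - k ^ p ^ n) -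
      (algebraMap K F (Algebra.norm K x) - x ^ p ^ n) := by
    rw [map_sub, map_pow]
    ring
  rw [this]
  exact vF.map_le_sub h2 h1

/-- If the residue field extension is trivial, the powers of a uniformizer below the ramification
index span a dense subspace. -/
theorem Extends.exists_mem_span_le_map_sub (hext : Extends vK vF e)
    (hres : ∀ x : F, 0 ≤ vF x → ∃ k : K, (1 : WithTop ℤ) ≤ vF (x - algebraMap K F k))
    {π : K} (hπ : vK π = ((1 : ℤ) : WithTop ℤ)) {ϖ : F} (hϖ : vF ϖ = ((1 : ℤ) : WithTop ℤ))
    {x : F} {m : ℤ} (hx : (m : WithTop ℤ) ≤ vF x) (n : ℕ) :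
    ∃ w ∈ Submodule.span K (Set.range fun i : Fin e => ϖ ^ (i : ℕ)),
      ((m + n : ℤ) : WithTop ℤ) ≤ vF (x - w) := by
  induction n with
  | zero => exact ⟨0, Submodule.zero_mem _, by simpa using hx⟩
  | succ n ih =>
    obtain ⟨w, hw, hxw⟩ := ih
    have he : (0 : ℤ) < e := by exact_mod_cast hext.1
    set N : ℤ := m + n with hN
    obtain ⟨i, hi⟩ : ∃ i : ℕ, (i : ℤ) = N % e :=
      ⟨(N % e).toNat, Int.toNat_of_nonneg (Int.emod_nonneg _ he.ne')⟩
    have hie : i < e := by exact_mod_cast hi ▸ Int.emod_lt_of_pos N he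
    set u : F := algebraMap K F (π ^ (N / e)) * ϖ ^ i with hu
    have hpow := map_zpow_eq_coe vK hπ (N / e)
    have huv : vF u = (N : ℤ) := by
      rw [hu, vF.map_mul, hext.map_algebraMap_eq_coe hpow, map_pow_eq_coe vF hϖ,
        ← WithTop.coe_add, hi]
      congr 1
      have := Int.mul_ediv_add_emod N e
      linarith
    have hu0 : u ≠ 0 := vF.ne_top_iff.1 (by simp [huv])
    have hinv : vF u⁻¹ = ((-N : ℤ) : WithTop ℤ) := by
      have := map_zpow_eq_coe vF huv (-1)
      simpa using this
    have hz : 0 ≤ vF ((x - w) * u⁻¹) := by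
      have := coe_add_le_map_mul vF hxw hinv.ge
      simpa using this
    obtain ⟨k, hk⟩ := hres _ hz
    refine ⟨w + (k * π ^ (N / e)) • ϖ ^ i, Submodule.add_mem _ hw (Submodule.smul_mem _ _
      (Submodule.subset_span ⟨⟨i, hie⟩, rfl⟩)), ?_⟩
    have heq : x - (w + (k * π ^ (N / e)) • ϖ ^ i) =
        ((x - w) * u⁻¹ - algebraMap K F k) * u := by
      rw [sub_mul, inv_mul_cancel_right₀ hu0, Algebra.smul_def, hu, map_mul]
      ring
    rw [heq]
    have := coe_add_le_map_mul vF (m := 1) (by exact_mod_cast hk) huv.ge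
    convert this using 2
    push_cast
    lia

/-- A Galois extension with trivial residue field extension is generated by the powers of a
uniformizer below the ramification index. -/
theorem Extends.span_pow_eq_top (hext : Extends vK vF e) (hGal : GalInvariant K vF)
    [FiniteDimensional K F] [IsGalois K F]
    (hres : ∀ x : F, 0 ≤ vF x → ∃ k : K, (1 : WithTop ℤ) ≤ vF (x - algebraMap K F k))
    {π : K} (hπ : vK π = ((1 : ℤ) : WithTop ℤ)) {ϖ : F} (hϖ : vF ϖ = ((1 : ℤ) : WithTop ℤ)) :
    Submodule.span K (Set.range fun i : Fin e => ϖ ^ (i : ℕ)) = ⊤ := by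
  by_contra hne
  obtain ⟨φ, hφ, hle⟩ := Submodule.exists_le_ker_of_lt_top _ (lt_top_iff_ne_top.2 hne)
  have hnd := traceForm_nondegenerate K F
  obtain ⟨z, hz⟩ := (LinearMap.BilinForm.toDual (Algebra.traceForm K F) hnd).surjective φ
  have hφz : ∀ x, φ x = Algebra.trace K F (z * x) := fun x => by
    rw [← hz]
    rfl
  refine hφ (LinearMap.ext fun x => ?_)
  by_contra hx
  have hx0 : x ≠ 0 := fun h => hx (by simp [h])
  have hz0 : z ≠ 0 := fun h => hx (by simp [hφz, h])
  obtain ⟨m, hm⟩ := exists_map_eq_coe vF hx0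
  obtain ⟨b, hb⟩ := exists_map_eq_coe vF hz0
  obtain ⟨d, hd⟩ := exists_map_eq_coe vF (x := algebraMap K F (φ x)) (by simpa using hx)
  obtain ⟨w, hw, hxw⟩ := hext.exists_mem_span_le_map_sub hres hπ hϖ hm.ge (d - m - b + 1).toNat
  have h1 : φ x = Algebra.trace K F (z * (x - w)) := by
    rw [← hφz, map_sub, LinearMap.mem_ker.1 (hle hw), sub_zero]
  rw [h1, trace_eq_sum_automorphisms] at hd
  have h2 : ((d + 1 : ℤ) : WithTop ℤ) ≤ vF (∑ σ : F ≃ₐ[K] F, σ (z * (x - w))) := by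
    refine vF.map_le_sum fun σ _ => ?_
    rw [hGal]
    refine le_trans ?_ (coe_add_le_map_mul vF hb.ge hxw)
    have := Int.self_le_toNat (d - m - b + 1)
    exact_mod_cast (by linarith : d + 1 ≤ b + (m + ((d - m - b + 1).toNat : ℤ)))
  rw [hd] at h2
  have : d + 1 ≤ d := by exact_mod_cast h2
  lia

theorem Extends.ramificationIdx_eq_finrank (hext : Extends vK vF e) [FiniteDimensional K F]
    {ϖ : F} (hϖ : vF ϖ = ((1 : ℤ) : WithTop ℤ))
    (hspan : Submodule.span K (Set.range fun i : Fin e => ϖ ^ (i : ℕ)) = ⊤) :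
    e = Module.finrank K F := by
  refine le_antisymm ?_ ?_
  · simpa using (hext.linearIndependent_pow hϖ).fintype_card_le_finrank
  · simpa using finrank_le_of_span_eq_top hspan

/-- Integral elements are integral combinations of the powers of a generating uniformizer. -/
theorem Extends.exists_eq_sum_smul_pow (hext : Extends vK vF e) {ϖ : F}
    (hϖ : vF ϖ = ((1 : ℤ) : WithTop ℤ))
    (hspan : Submodule.span K (Set.range fun i : Fin e => ϖ ^ (i : ℕ)) = ⊤) {x : F}
    (hx : 0 ≤ vF x) : ∃ k : Fin e → K, (∀ i, 0 ≤ vK (k i)) ∧ x = ∑ i, k i • ϖ ^ (i : ℕ) := by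
  obtain ⟨k, hk⟩ := (Submodule.mem_span_range_iff_exists_fun K).1
    (hspan ▸ Submodule.mem_top : x ∈ Submodule.span K (Set.range fun i : Fin e => ϖ ^ (i : ℕ)))
  refine ⟨k, fun i => ?_, hk.symm⟩
  by_cases hki : k i = 0
  · simp [hki]
  have hpow : ∀ i : Fin e, vF (ϖ ^ (i : ℕ)) = (((i : ℕ) : ℤ) : WithTop ℤ) := fun i => by
    simpa using map_pow_eq_coe vF hϖ i
  have h1 : 0 ≤ vF (k i • ϖ ^ (i : ℕ)) := by
    refine hx.trans ?_
    rw [← hk]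
    exact hext.map_sum_smul_le Finset.univ (x := fun i : Fin e => ϖ ^ (i : ℕ))
      (r := fun i => ((i : ℕ) : ℤ)) hpow (fun i j h => fin_eq_of_dvd_sub h) k (Finset.mem_univ i)
  obtain ⟨m, hm, hm'⟩ := hext.exists_map_smul_eq hki (hpow i)
  rw [hm'] at h1
  rw [hm]
  have := i.2
  norm_cast at h1 ⊢
  by_contra hneg
  push Not at hneg
  nlinarith

end Extension

section Ramification

open Polynomial IntermediateField

variable {vK : AddValuation K (WithTop ℤ)} {vF : AddValuation F (WithTop ℤ)} {e : ℕ}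

/-- The valuation ring of an additive valuation, as a subring. -/
def valuationRing (v : AddValuation F (WithTop ℤ)) : Subring F where
  carrier := {x | 0 ≤ v x}
  mul_mem' := map_mul_nonneg v
  one_mem' := by simp
  add_mem' := v.map_le_add
  zero_mem' := by simp
  neg_mem' := by simp

theorem mem_valuationRing {v : AddValuation F (WithTop ℤ)} {x : F} :
    x ∈ valuationRing v ↔ 0 ≤ v x := Iff.rfl

/-- A generator of a degree `p` subextension whose valuation is `e * l` and which is moved by
automorphisms by elements of valuation `e * (l + t)`. -/
structure IsJumpGenerator (K : Type*) {F : Type*} [Field K] [Field F] [Algebra K F]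
    (v : AddValuation F (WithTop ℤ)) (p e l t : ℕ) (β : F) : Prop where
  finrank_eq : Module.finrank K K⟮β⟯ = p
  map_eq : v β = ((e * l : ℤ) : WithTop ℤ)
  map_sub_eq : ∀ σ : F ≃ₐ[K] F, σ β ≠ β → v (σ β - β) = ((e * (l + t) : ℤ) : WithTop ℤ)

variable {p e' l t : ℕ} {β : F}

theorem IsJumpGenerator.ne_zero (hβ : IsJumpGenerator K vF p e' l t β) : β ≠ 0 :=
  vF.ne_top_iff.1 (by rw [hβ.map_eq]; exact WithTop.coe_ne_top)

theorem IsJumpGenerator.map_div (hβ : IsJumpGenerator K vF p e' l t β) (hGal : GalInvariant K vF)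
    (σ : F ≃ₐ[K] F) : vF (σ β / β) = 0 := by
  have h := hGal σ β
  rw [← div_mul_cancel₀ (σ β) hβ.ne_zero, vF.map_mul, hβ.map_eq] at h
  exact WithTop.add_right_cancel WithTop.coe_ne_top (by rw [h, zero_add])

theorem IsJumpGenerator.map_div_sub_one (hβ : IsJumpGenerator K vF p e' l t β) (σ : F ≃ₐ[K] F)
    (hσ : σ β ≠ β) : vF (σ β / β - 1) = ((e' * t : ℤ) : WithTop ℤ) := by
  have h := hβ.map_sub_eq σ hσ
  rw [show σ β - β = (σ β / β - 1) * β by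
    rw [sub_mul, div_mul_cancel₀ _ hβ.ne_zero, one_mul], vF.map_mul, hβ.map_eq] at h
  refine WithTop.add_right_cancel (WithTop.coe_ne_top (a := (e' * l : ℤ))) ?_
  rw [h, ← WithTop.coe_add]
  congr 1
  ring

theorem IsJumpGenerator.le_map_div_sub_one (hβ : IsJumpGenerator K vF p e' l t β)
    (σ : F ≃ₐ[K] F) : ((e' * t : ℤ) : WithTop ℤ) ≤ vF (σ β / β - 1) := by
  by_cases hσ : σ β = β
  · simp [hσ, div_self hβ.ne_zero]
  · exact (hβ.map_div_sub_one σ hσ).ge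

/-- Every integral element of the field generated by a jump generator is moved by at least
`e' * (t + 1)`. -/
theorem IsJumpGenerator.le_map_sub (hβ : IsJumpGenerator K vF p e' l t β)
    (hext : Extends vK vF (p * e')) (hGal : GalInvariant K vF) [FiniteDimensional K F]
    (hp : p.Prime) (hl : ¬ p ∣ l) (σ : F ≃ₐ[K] F) {y : F} (hy : y ∈ K⟮β⟯) (hyv : 0 ≤ vF y) :
    ((e' * (t + 1) : ℤ) : WithTop ℤ) ≤ vF (σ y - y) := by
  have he' : (0 : ℤ) < e' := by exact_mod_cast Nat.pos_of_mul_pos_left hext.1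
  have hpow : ∀ i : Fin p, vF (β ^ (i : ℕ)) = (((i : ℕ) * (e' * l) : ℤ) : WithTop ℤ) :=
    fun i => map_pow_eq_coe vF hβ.map_eq i
  have hpl : IsCoprime (p : ℤ) l :=
    Nat.isCoprime_iff_coprime.2 ((Nat.Prime.coprime_iff_not_dvd hp).2 hl)
  have hdist : ∀ i j : Fin p, ((p * e' : ℕ) : ℤ) ∣ (i : ℕ) * (e' * l) - (j : ℕ) * (e' * l) →
      i = j := by
    intro i j h
    refine fin_eq_of_dvd_sub (hpl.dvd_of_dvd_mul_right ?_)
    refine Int.dvd_of_mul_dvd_mul_right he'.ne' ?_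
    convert h using 1
    · push_cast; rfl
    · ring
  have hspan : Submodule.span K (Set.range fun i : Fin p => β ^ (i : ℕ)) =
      Subalgebra.toSubmodule K⟮β⟯.toSubalgebra := by
    refine Submodule.eq_of_le_of_finrank_le (Submodule.span_le.2 ?_) ?_
    · rintro _ ⟨i, rfl⟩
      exact pow_mem (mem_adjoin_simple_self K β) _
    · rw [finrank_span_eq_card (hext.linearIndependent hpow hdist), Fintype.card_fin]
      exact hβ.finrank_eq.le
  obtain ⟨k, rfl⟩ := (Submodule.mem_span_range_iff_exists_fun K).1
    (hspan ▸ hy : y ∈ Submodule.span K (Set.range fun i : Fin p => β ^ (i : ℕ)))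
  rw [map_sum, ← Finset.sum_sub_distrib]
  refine vF.map_le_sum fun i _ => ?_
  by_cases hki : k i = 0
  · simp [hki]
  by_cases hi : (i : ℕ) = 0
  · simp [hi]
  have hσi : σ (k i • β ^ (i : ℕ)) - k i • β ^ (i : ℕ) =
      (k i • β ^ (i : ℕ)) * ((σ β / β) ^ (i : ℕ) - 1) := by
    have := hβ.ne_zero
    rw [map_smul, map_pow, ← smul_sub, smul_mul_assoc, div_pow]
    congr 1
    field_simp
  rw [hσi]
  have h1 : 0 ≤ vF (k i • β ^ (i : ℕ)) :=
    hyv.trans (hext.map_sum_smul_le Finset.univ hpow hdist k (Finset.mem_univ i))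
  obtain ⟨m, -, hm⟩ := hext.exists_map_smul_eq hki (hpow i)
  have h2 : ((e' : ℤ) : WithTop ℤ) ≤ vF (k i • β ^ (i : ℕ)) := by
    rw [hm] at h1 ⊢
    have hfac : ((p * e' : ℕ) : ℤ) * m + (i : ℕ) * (e' * l) = e' * (p * m + (i : ℕ) * l) := by
      push_cast; ring
    rw [hfac] at h1 ⊢
    have h3 : 0 ≤ (e' : ℤ) * (p * m + (i : ℕ) * l) := by exact_mod_cast h1
    have h4 : (p : ℤ) * m + (i : ℕ) * l ≠ 0 := by
      intro h
      have h5 : (p : ℤ) ∣ (i : ℕ) * l := ⟨-m, by linarith⟩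
      have h6 : p ∣ (i : ℕ) := by exact_mod_cast hpl.dvd_of_dvd_mul_right h5
      exact absurd (Nat.le_of_dvd (Nat.pos_of_ne_zero hi) h6) (not_le.2 i.2)
    have h5 : 0 ≤ (p : ℤ) * m + (i : ℕ) * l := nonneg_of_mul_nonneg_right h3 he'
    have h6 : 1 ≤ (p : ℤ) * m + (i : ℕ) * l := by lia
    exact WithTop.coe_le_coe.2 (by nlinarith)
  have h3 := le_map_pow_sub_one vF (hβ.map_div hGal σ).ge (hβ.le_map_div_sub_one σ) i
  have h4 := coe_add_le_map_mul vF h2 h3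
  rwa [show (e' : ℤ) + e' * t = e' * (t + 1) by ring] at h4

theorem le_map_prod_sub (hGal : GalInvariant K vF) [FiniteDimensional K F] [IsGalois K F]
    (E : IntermediateField K F) (σ : F ≃ₐ[K] F) {m : ℤ}
    (hE : ∀ y ∈ E, 0 ≤ vF y → (m : WithTop ℤ) ≤ vF (σ y - y)) {x : F} (hx : 0 ≤ vF x) :
    (m : WithTop ℤ) ≤ vF (∏ h : E.fixingSubgroup, (x - σ ((h : F ≃ₐ[K] F) x))) := by
  set O := valuationRing vF
  have hmem : ∀ τ : F ≃ₐ[K] F, τ x ∈ O := fun τ => by rwa [mem_valuationRing, hGal]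
  set Q : O[X] := ∏ h : E.fixingSubgroup, (X - C ⟨(h : F ≃ₐ[K] F) x, hmem h⟩) with hQ
  set P : F[X] := ∏ h : E.fixingSubgroup, (X - C ((h : F ≃ₐ[K] F) x)) with hP
  have hQP : Q.map O.subtype = P := by
    rw [hQ, hP, Polynomial.map_prod]
    simp
  have hint : ∀ n, 0 ≤ vF (P.coeff n) := fun n => by
    rw [← hQP, coeff_map]
    exact (Q.coeff n).2
  have hfix : ∀ n, P.coeff n ∈ E := fun n => by
    rw [← IsGalois.fixedField_fixingSubgroup E]
    rintro ⟨h, hh⟩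
    change h (P.coeff n) = P.coeff n
    have : P.map (h : F →+* F) = P := by
      rw [hP, Polynomial.map_prod]
      refine Fintype.prod_equiv (Equiv.mulLeft (⟨h, hh⟩ : E.fixingSubgroup)) _ _ fun g => ?_
      simp
    conv_rhs => rw [← this, coeff_map]
    rfl
  have h0 : P.eval x = 0 := by
    rw [hP, eval_prod]
    exact Finset.prod_eq_zero (Finset.mem_univ 1) (by simp)
  have h1 : (P.map (σ : F →+* F)).eval x = ∏ h : E.fixingSubgroup, (x - σ ((h : F ≃ₐ[K] F) x)) := by
    rw [hP, Polynomial.map_prod, eval_prod]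
    simp
  rw [← h1, ← sub_zero (eval x _), ← h0, eval_map, eval₂_eq_sum_range, eval_eq_sum_range,
    ← Finset.sum_sub_distrib]
  refine vF.map_le_sum fun n _ => ?_
  rw [← sub_mul]
  exact coe_le_map_mul_right vF (hE _ (hfix n) (hint n)) (map_pow_nonneg vF hx n)

/-- The automorphisms that move `x` by at least `m`. -/
def displacementSubgroup (hGal : GalInvariant K vF) (x : F) (m : ℤ) : Subgroup (F ≃ₐ[K] F) where
  carrier := {σ | (m : WithTop ℤ) ≤ vF (σ x - x)}
  one_mem' := by simp
  mul_mem' := by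
    intro a b ha hb
    have h : (a * b) x - x = a (b x - x) + (a x - x) := by
      rw [AlgEquiv.mul_apply, map_sub]
      ring
    change _ ≤ vF _
    rw [h]
    exact vF.map_le_add (by rwa [hGal]) ha
  inv_mem' := by
    intro a ha
    change _ ≤ vF _
    have h : a (a⁻¹ x - x) = x - a x := by
      rw [map_sub]
      congr 1
      exact a.apply_symm_apply x
    rw [← hGal a, h, vF.map_sub_swap]
    exact ha

theorem IsJumpGenerator.card_fixingSubgroup (hβ : IsJumpGenerator K vF p e' l t β)
    [FiniteDimensional K F] [IsGalois K F] :
    p * Fintype.card K⟮β⟯.fixingSubgroup = Module.finrank K F := by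
  rw [← Nat.card_eq_fintype_card, IsGalois.card_fixingSubgroup_eq_finrank]
  conv_lhs => rw [← hβ.finrank_eq]
  exact Module.finrank_mul_finrank K K⟮β⟯ F

theorem mul_le_of_displacementSubgroup_ne_top (hext : Extends vK vF (p * e'))
    (hGal : GalInvariant K vF) [FiniteDimensional K F] [IsGalois K F] (hp : p.Prime) (hl : ¬ p ∣ l)
    (hgen : ∀ S : Subgroup (F ≃ₐ[K] F), S ≠ ⊤ → ∃ β, IsJumpGenerator K vF p e' l t β ∧
      S ≤ K⟮β⟯.fixingSubgroup)
    {x : F} (hx : 0 ≤ vF x) {m : ℤ} (hm : displacementSubgroup hGal x m ≠ ⊤) :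
    (p * e' * (t + 1) : ℤ) ≤ Module.finrank K F * (m - 1) := by
  obtain ⟨β, hβ, hle⟩ := hgen _ hm
  obtain ⟨σ, hσ⟩ : ∃ σ, σ ∉ K⟮β⟯.fixingSubgroup := by
    by_contra! h
    have h1 := IsGalois.fixedField_fixingSubgroup K⟮β⟯
    rw [(Subgroup.eq_top_iff' _).2 h, IsGalois.fixedField_top] at h1
    have h2 := hβ.finrank_eq
    rw [← h1, IntermediateField.finrank_bot] at h2
    exact hp.one_lt.ne h2
  have h1 := le_map_prod_sub hGal K⟮β⟯ σ
    (fun y hy hyv => hβ.le_map_sub hext hGal hp hl σ hy hyv) hx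
  have h2 := map_prod_le_card_mul vF Finset.univ
    (fun h : K⟮β⟯.fixingSubgroup => x - σ ((h : F ≃ₐ[K] F) x)) (m := m - 1) fun h _ => by
      have h3 : σ * h ∉ displacementSubgroup hGal x m := fun h4 =>
        hσ ((Subgroup.mul_mem_cancel_right _ h.2).1 (hle h4))
      have h4 : vF (x - σ ((h : F ≃ₐ[K] F) x)) < m := by
        rw [vF.map_sub_swap]
        exact not_le.1 h3
      obtain ⟨n, hn⟩ := WithTop.ne_top_iff_exists.1 (h4.trans_le le_top).ne
      rw [← hn] at h4 ⊢
      have h5 : n < m := by exact_mod_cast h4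
      exact WithTop.coe_le_coe.2 (by lia)
  have h3 : (e' * (t + 1) : ℤ) ≤ Fintype.card K⟮β⟯.fixingSubgroup * (m - 1) := by
    exact_mod_cast h1.trans h2
  rw [← hβ.card_fixingSubgroup]
  push_cast
  rw [mul_assoc, mul_assoc]
  exact mul_le_mul_of_nonneg_left h3 (by positivity)

end Ramification

section RamificationGroups

open Polynomial IntermediateField

variable {vK : AddValuation K (WithTop ℤ)} {vF : AddValuation F (WithTop ℤ)} {e : ℕ}
variable {p e' l t : ℕ} {β : F}

theorem prod_X_sub_C_dvd_of_isRoot {R ι : Type*} [CommRing R] [IsDomain R] [Fintype ι]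
    {f : ι → R} (hf : Function.Injective f) {g : R[X]} (hg : ∀ i, g.IsRoot (f i)) :
    ∏ i, (X - C (f i)) ∣ g := by
  by_cases h0 : g = 0
  · simp [h0]
  have h := (Multiset.prod_X_sub_C_dvd_iff_le_roots h0 (Finset.univ.val.map f)).2
    ((Multiset.le_iff_subset (Finset.univ.nodup.map hf)).2 fun a ha => by
      obtain ⟨i, -, rfl⟩ := Multiset.mem_map.1 ha
      exact (mem_roots h0).2 (hg i))
  rwa [Multiset.map_map] at h

theorem exists_mul_add_eq_one {p l : ℕ} (hp : p.Prime) (hl : ¬ p ∣ l) :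
    ∃ (i : ℕ) (j : ℤ), (i * l + p * j : ℤ) = 1 ∧ ¬ p ∣ i := by
  obtain ⟨a, b, hab⟩ : IsCoprime (l : ℤ) p :=
    (Nat.isCoprime_iff_coprime.2 ((Nat.Prime.coprime_iff_not_dvd hp).2 hl)).symm
  have hp0 : (p : ℤ) ≠ 0 := by exact_mod_cast hp.ne_zero
  have hi := Int.toNat_of_nonneg (Int.emod_nonneg a hp0)
  have hmod := Int.mul_ediv_add_emod a p
  have h1 : ((a % p).toNat * l + p * (b + a / p * l) : ℤ) = 1 := by
    rw [hi]
    linear_combination hab + hmod * (l : ℤ)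
  refine ⟨(a % p).toNat, b + a / p * l, h1, fun h => ?_⟩
  have h2 : (p : ℤ) ∣ 1 := h1 ▸ dvd_add (Dvd.dvd.mul_right (by exact_mod_cast h) _) ⟨_, rfl⟩
  have h3 : p ∣ 1 := by exact_mod_cast h2
  exact hp.one_lt.ne' (Nat.dvd_one.1 h3)

theorem eq_of_apply_eq {ϖ : F}
    (hspan : Submodule.span K (Set.range fun i : Fin e => ϖ ^ (i : ℕ)) = ⊤) {σ τ : F ≃ₐ[K] F}
    (h : σ ϖ = τ ϖ) : σ = τ := by
  have : σ.toLinearMap = τ.toLinearMap := LinearMap.ext_on_range hspan fun i => by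
    simp [h]
  exact AlgEquiv.ext fun x => LinearMap.congr_fun this x

/-- If all automorphisms move integral elements by at least `t + 1` then an automorphism moving a
uniformizer by at least `t + 2` fixes every jump generator. -/
theorem IsJumpGenerator.apply_eq (hβ : IsJumpGenerator K vF p e' l t β)
    (hext : Extends vK vF (p * e')) (hGal : GalInvariant K vF) [FiniteDimensional K F]
    [IsGalois K F] (hp : p.Prime) (hpv : (1 : WithTop ℤ) ≤ vF (p : F)) (hl : ¬ p ∣ l) (ht0 : 1 ≤ t)
    {π : K} (hπ : vK π = ((1 : ℤ) : WithTop ℤ)) {ϖ : F} (hϖ : vF ϖ = ((1 : ℤ) : WithTop ℤ))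
    (hspan : Submodule.span K (Set.range fun i : Fin (p * e') => ϖ ^ (i : ℕ)) = ⊤)
    (ht : ∀ (σ : F ≃ₐ[K] F) (x : F), 0 ≤ vF x → ((t + 1 : ℤ) : WithTop ℤ) ≤ vF (σ x - x))
    {τ : F ≃ₐ[K] F} (hτ : ((t + 2 : ℤ) : WithTop ℤ) ≤ vF (τ ϖ - ϖ)) : τ β = β := by
  by_contra hne
  have he' : (0 : ℤ) < e' := by exact_mod_cast Nat.pos_of_mul_pos_left hext.1
  have hcard : Fintype.card K⟮β⟯.fixingSubgroup = e' := by
    have h := hβ.card_fixingSubgroup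
    rw [← hext.ramificationIdx_eq_finrank hϖ hspan] at h
    exact Nat.eq_of_mul_eq_mul_left hp.pos h
  obtain ⟨i, j, hij, hi⟩ := exists_mul_add_eq_one hp hl
  set y : F := β ^ i * algebraMap K F (π ^ j) with hy
  have hyE : y ∈ K⟮β⟯ :=
    mul_mem (pow_mem (mem_adjoin_simple_self K β) _) (K⟮β⟯.algebraMap_mem _)
  have hyv : vF y = ((e' : ℤ) : WithTop ℤ) := by
    rw [hy, vF.map_mul, map_pow_eq_coe vF hβ.map_eq,
      hext.map_algebraMap_eq_coe (map_zpow_eq_coe vK hπ j), ← WithTop.coe_add]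
    congr 1
    push_cast
    linear_combination (e' : ℤ) * hij
  have hyint : 0 ≤ vF y := by
    rw [hyv]
    exact_mod_cast he'.le
  have hτy : vF (y - τ y) = ((e' * (t + 1) : ℤ) : WithTop ℤ) := by
    have h1 : τ y - y = y * ((τ β / β) ^ i - 1) := by
      have := hβ.ne_zero
      rw [hy, map_mul, map_pow, AlgEquiv.commutes, div_pow]
      field_simp
    have h2 := hβ.map_div_sub_one τ hne
    have h3 : (1 : WithTop ℤ) ≤ vF (τ β / β - 1) := by
      rw [h2]
      exact_mod_cast (by nlinarith : (1 : ℤ) ≤ e' * t)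
    rw [vF.map_sub_swap, h1, vF.map_mul, map_pow_sub_one_eq vF (hβ.map_div hGal τ).ge h3
      (map_natCast_eq_zero vF hp hpv hi), h2, hyv, ← WithTop.coe_add]
    congr 1
    ring
  obtain ⟨k, hk, hyk⟩ := hext.exists_eq_sum_smul_pow hϖ hspan hyint
  set O := valuationRing vF
  have hkO : ∀ i, algebraMap K F (k i) ∈ O := fun i => hext.map_algebraMap_nonneg_iff.2 (hk i)
  have hϖint : 0 ≤ vF ϖ := by
    rw [hϖ]
    exact zero_le_one
  have hϖO : ∀ σ : F ≃ₐ[K] F, σ ϖ ∈ O := fun σ => by rwa [mem_valuationRing, hGal]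
  have hyO : ∀ σ : F ≃ₐ[K] F, σ y ∈ O := fun σ => by rwa [mem_valuationRing, hGal]
  set g : O[X] := ∑ i : Fin (p * e'), C ⟨algebraMap K F (k i), hkO i⟩ * X ^ (i : ℕ) with hg
  have hgσ : ∀ σ : F ≃ₐ[K] F, g.eval ⟨σ ϖ, hϖO σ⟩ = ⟨σ y, hyO σ⟩ := fun σ => by
    refine Subtype.ext ?_
    change _ = σ y
    rw [hg, eval_finsetSum, hyk, map_sum, AddSubmonoidClass.coe_finsetSum]
    refine Finset.sum_congr rfl fun i _ => ?_
    simp [Algebra.smul_def]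
  have hdvd := prod_X_sub_C_dvd_of_isRoot
    (f := fun h : K⟮β⟯.fixingSubgroup => (⟨(τ * h) ϖ, hϖO _⟩ : O))
    (g := g - C ⟨τ y, hyO τ⟩) (fun h₁ h₂ h => by
      have h3 := eq_of_apply_eq hspan (congrArg Subtype.val h)
      exact Subtype.ext (mul_left_cancel h3)) (fun h => by
      rw [IsRoot, eval_sub, hgσ, eval_C, sub_eq_zero]
      refine Subtype.ext ?_
      change τ ((h : F ≃ₐ[K] F) y) = τ y
      congr 1
      exact (IntermediateField.mem_fixingSubgroup_iff _ _).1 h.2 y hyE)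
  have hdvd' := eval_dvd (x := (⟨ϖ, hϖint⟩ : O)) hdvd
  obtain ⟨q, hq⟩ := hdvd'
  have hq' := congrArg Subtype.val hq
  have h1 : eval (⟨ϖ, hϖint⟩ : O) g = ⟨y, hyint⟩ := hgσ 1
  rw [eval_sub, h1, eval_C, eval_prod] at hq'
  have hq'' : y - τ y =
      (∏ h : K⟮β⟯.fixingSubgroup, (ϖ - τ ((h : F ≃ₐ[K] F) ϖ))) * (q : F) := by
    simpa using hq'
  rw [← Finset.mul_prod_erase _ _ (Finset.mem_univ 1)] at hq''
  have h2 := card_mul_le_map_prod vF (Finset.univ.erase 1)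
    (fun h : K⟮β⟯.fixingSubgroup => ϖ - τ ((h : F ≃ₐ[K] F) ϖ)) (m := t + 1) fun h _ => by
      rw [vF.map_sub_swap]
      exact ht (τ * h) ϖ hϖint
  rw [Finset.card_erase_of_mem (Finset.mem_univ _), Finset.card_univ, hcard,
    Nat.cast_sub (by lia)] at h2
  have h3 : ((t + 2 : ℤ) : WithTop ℤ) ≤
      vF (ϖ - τ (((1 : K⟮β⟯.fixingSubgroup) : F ≃ₐ[K] F) ϖ)) := by
    rw [vF.map_sub_swap]
    exact hτ
  have h4 := coe_le_map_mul_right vF (coe_add_le_map_mul vF h3 h2) q.2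
  rw [← hq'', hτy] at h4
  have h5 : (t + 2 : ℤ) + (e' - (1 : ℕ)) * (t + 1) ≤ e' * (t + 1) := by exact_mod_cast h4
  push_cast at h5
  nlinarith

/-- The ramification groups of an extension with sufficiently many jump generators. -/
theorem lowerRG_of_isJumpGenerator (hext : Extends vK vF e) (hGal : GalInvariant K vF)
    (hvF : IsNormalized vF) [FiniteDimensional K F] [IsGalois K F] (hp : p.Prime)
    (hpv : (1 : WithTop ℤ) ≤ vK (p : K)) {f : ℕ} {c : Fin f → K} (hc : IsResidueBasis p vK c)
    (hn : ∃ n, Module.finrank K F = p ^ n) (he : e = p * e') (hl : ¬ p ∣ l) (ht0 : 1 ≤ t)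
    {π : K} (hπ : vK π = ((1 : ℤ) : WithTop ℤ))
    (hgen : ∀ S : Subgroup (F ≃ₐ[K] F), S ≠ ⊤ → ∃ β, IsJumpGenerator K vF p e' l t β ∧
      S ≤ K⟮β⟯.fixingSubgroup)
    (hne : ∀ τ : F ≃ₐ[K] F, τ ≠ 1 → ∃ β, IsJumpGenerator K vF p e' l t β ∧ τ β ≠ β) :
    (∀ i : ℤ, i ≤ t → lowerRG vF hGal i = ⊤) ∧ ∀ i : ℤ, t < i → lowerRG vF hGal i = ⊥ := by
  subst he
  obtain ⟨n, hn⟩ := hn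
  have he' : 0 < e' := Nat.pos_of_mul_pos_left hext.1
  have key : ∀ {x : F}, 0 ≤ vF x → ∀ {m : ℤ},
      (Module.finrank K F * (m - 1) : ℤ) < (p * e' * (t + 1) : ℤ) →
      ∀ σ : F ≃ₐ[K] F, (m : WithTop ℤ) ≤ vF (σ x - x) := fun {x} hx m hm σ => by
    by_contra h
    refine hm.not_ge (mul_le_of_displacementSubgroup_ne_top hext hGal hp hl hgen hx fun h' => ?_)
    exact h (h' ▸ Subgroup.mem_top σ : σ ∈ displacementSubgroup hGal x m)
  have hpe : (0 : ℤ) < p * e' * (t + 1) := by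
    have := hp.pos
    positivity
  obtain ⟨ϖ, hϖ⟩ := hvF 1
  have hspan := hext.span_pow_eq_top hGal (fun x hx => by
    obtain ⟨k, -, hk⟩ := hext.exists_one_le_map_sub hp hpv hc hn (fun σ x hx => by
      exact_mod_cast key hx (m := 1) (by simpa using hpe) σ) hx
    exact ⟨k, hk⟩) hπ hϖ
  have hfin := hext.ramificationIdx_eq_finrank hϖ hspan
  have ht : ∀ (σ : F ≃ₐ[K] F) (x : F), 0 ≤ vF x → ((t + 1 : ℤ) : WithTop ℤ) ≤ vF (σ x - x) := by
    intro σ x hx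
    refine key hx ?_ σ
    rw [← hfin]
    push_cast
    have : (0 : ℤ) < p * e' := by exact_mod_cast Nat.mul_pos hp.pos he'
    nlinarith
  have hpF : (1 : WithTop ℤ) ≤ vF (p : F) := by simpa using hext.one_le_map_algebraMap hpv
  refine ⟨fun i hi => (Subgroup.eq_top_iff' _).2 fun σ x hx => le_trans ?_ (ht σ x hx),
    fun i hi => (Subgroup.eq_bot_iff_forall _).2 fun τ hτ => ?_⟩
  · exact_mod_cast (by lia : i + 1 ≤ t + 1)
  · by_contra h1
    obtain ⟨β, hβ, hτβ⟩ := hne τ h1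
    refine hτβ (hβ.apply_eq hext hGal hp hpF hl ht0 hπ hϖ hspan ht (le_trans ?_ (hτ ϖ ?_)))
    · exact_mod_cast (by lia : (t + 2 : ℤ) ≤ i + 1)
    · rw [hϖ]
      exact zero_le_one

end RamificationGroups

section UpperNumbering

variable {v : AddValuation F (WithTop ℤ)} {hv : GalInvariant K v} {t : ℕ}

theorem herbrandPhi_of_le [Finite (F ≃ₐ[K] F)] (htop : ∀ i : ℤ, i ≤ t → lowerRG v hv i = ⊤)
    {n : ℤ} (hn : n ≤ t) : herbrandPhi v hv n = n := by
  rw [herbrandPhi]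
  split_ifs with h
  · rfl
  push Not at h
  have hsum : ∑ i ∈ Finset.Icc (1 : ℤ) n, (Nat.card (lowerRG v hv i) : ℚ) =
      ∑ i ∈ Finset.Icc (1 : ℤ) n, (Nat.card (F ≃ₐ[K] F) : ℚ) :=
    Finset.sum_congr rfl fun i hi => by
      rw [htop i ((Finset.mem_Icc.1 hi).2.trans hn), Subgroup.card_top]
  have hcard : (Nat.card (F ≃ₐ[K] F) : ℚ) ≠ 0 := by exact_mod_cast Nat.card_pos.ne'
  rw [hsum, htop 0 (by positivity), Subgroup.card_top, Finset.sum_const, nsmul_eq_mul,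
    mul_div_cancel_right₀ _ hcard, Int.card_Icc, add_sub_cancel_right]
  exact_mod_cast Int.toNat_of_nonneg h.le

theorem exists_le_herbrandPhi [Finite (F ≃ₐ[K] F)] (u : ℤ) :
    ∃ n : ℤ, (u : ℚ) ≤ herbrandPhi v hv n := by
  by_cases hu : u ≤ 0
  · exact ⟨u, by simp [herbrandPhi, hu]⟩
  push Not at hu
  set N := Nat.card (lowerRG v hv 0)
  have hN : 0 < N := Nat.card_pos
  have hn : 0 < u * N := by positivity
  refine ⟨u * N, ?_⟩
  rw [herbrandPhi, if_neg hn.not_ge, le_div_iff₀ (by exact_mod_cast hN)]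
  have h : ∑ i ∈ Finset.Icc (1 : ℤ) (u * N), (1 : ℚ) ≤
      ∑ i ∈ Finset.Icc (1 : ℤ) (u * N), (Nat.card (lowerRG v hv i) : ℚ) :=
    Finset.sum_le_sum fun i _ => by exact_mod_cast Nat.card_pos
  rw [Finset.sum_const, nsmul_eq_mul, mul_one, Int.card_Icc, add_sub_cancel_right] at h
  refine le_trans ?_ h
  exact_mod_cast (Int.toNat_of_nonneg hn.le).ge

theorem upperRG_of_le [Finite (F ≃ₐ[K] F)] (htop : ∀ i : ℤ, i ≤ t → lowerRG v hv i = ⊤)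
    {u : ℤ} (hu : u ≤ t) : upperRG v hv u = ⊤ := by
  have h : IsLeast {n : ℤ | (u : ℚ) ≤ herbrandPhi v hv n} u := by
    refine ⟨(herbrandPhi_of_le htop hu).ge, fun n hn => ?_⟩
    by_contra hlt
    push Not at hlt
    rw [Set.mem_ofPred_eq, herbrandPhi_of_le htop (hlt.le.trans hu)] at hn
    exact hlt.not_ge (by exact_mod_cast hn)
  rw [upperRG, h.csInf_eq, htop u hu]

theorem upperRG_of_lt [Finite (F ≃ₐ[K] F)] (htop : ∀ i : ℤ, i ≤ t → lowerRG v hv i = ⊤)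
    (hbot : ∀ i : ℤ, t < i → lowerRG v hv i = ⊥) {u : ℤ} (hu : t < u) : upperRG v hv u = ⊥ := by
  have hlt : ∀ n : ℤ, (u : ℚ) ≤ herbrandPhi v hv n → t < n := fun n hn => by
    by_contra hle
    push Not at hle
    rw [herbrandPhi_of_le htop hle] at hn
    exact (hle.trans_lt hu).not_ge (by exact_mod_cast hn)
  exact hbot _ (hlt _ (Int.csInf_mem (s := {n : ℤ | (u : ℚ) ≤ herbrandPhi v hv n})
    (exists_le_herbrandPhi u) ⟨t, fun n hn => (hlt n hn).le⟩))

theorem isUpperJump_iff_eq [Finite (F ≃ₐ[K] F)] [Nontrivial (F ≃ₐ[K] F)]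
    (htop : ∀ i : ℤ, i ≤ t → lowerRG v hv i = ⊤) (hbot : ∀ i : ℤ, t < i → lowerRG v hv i = ⊥)
    (s : ℤ) : IsUpperJump v hv s ↔ s = t := by
  constructor
  · intro h
    rcases lt_trichotomy s t with hs | hs | hs
    · exact absurd (by rw [upperRG_of_le htop le_rfl, upperRG_of_le htop hs.le]) (h t hs)
    · exact hs
    · exact absurd (by rw [upperRG_of_lt htop hbot hs, upperRG_of_lt htop hbot (by lia)])
        (h (s + 1) (by lia))
  · rintro rfl u hu
    rw [upperRG_of_le htop le_rfl, upperRG_of_lt htop hbot hu]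
    exact bot_ne_top

end UpperNumbering

section Kummer

open Polynomial IntermediateField

/-- `F` is generated over `K ∋ ζ` by `p`-th roots `α y` of elements `u y` that are independent
modulo `p`-th powers. -/
structure IsKummerSystem (p : ℕ) (ζ : K) {f : ℕ} (u : Fin f → K) (α : Fin f → F) : Prop where
  isPrimitiveRoot : IsPrimitiveRoot ζ p
  pow_eq : ∀ y, α y ^ p = algebraMap K F (u y)
  adjoin_eq_top : adjoin K (Set.range α) = ⊤
  pow_ne : ∀ a : Fin f → ZMod p, a ≠ 0 → ∀ b : K, b ^ p ≠ ∏ y, u y ^ (a y).val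

/-- The monomial `∏ y, α y ^ a y` with exponents in `{0, …, p - 1}`. -/
def monomialVal {p f : ℕ} (α : Fin f → F) (a : Fin f → ZMod p) : F := ∏ y, α y ^ (a y).val

variable {p f : ℕ} {ζ : K} {u : Fin f → K} {α : Fin f → F}

namespace IsKummerSystem

theorem monomialVal_pow (h : IsKummerSystem p ζ u α) (a : Fin f → ZMod p) :
    monomialVal α a ^ p = algebraMap K F (∏ y, u y ^ (a y).val) := by
  rw [monomialVal, ← Finset.prod_pow, map_prod]
  refine Finset.prod_congr rfl fun y _ => ?_
  rw [← pow_mul, mul_comm, pow_mul, h.pow_eq, map_pow]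

theorem isPrimitiveRoot_algebraMap (h : IsKummerSystem p ζ u α) :
    IsPrimitiveRoot (algebraMap K F ζ) p :=
  h.isPrimitiveRoot.map_of_injective (algebraMap K F).injective

variable [Fact p.Prime]

theorem ne_zero (h : IsKummerSystem p ζ u α) (y : Fin f) : α y ≠ 0 := by
  intro h0
  have hp := (Fact.out : p.Prime)
  have hu : u y = 0 := by
    have := h.pow_eq y
    rw [h0, zero_pow hp.ne_zero] at this
    exact (map_eq_zero (algebraMap K F)).1 this.symm
  refine h.pow_ne (Pi.single y 1) (by simp) 0 ?_
  rw [zero_pow hp.ne_zero, Finset.prod_eq_zero (Finset.mem_univ y)]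
  have : Fact (1 < p) := ⟨hp.one_lt⟩
  simp [hu, ZMod.val_one]

theorem monomialVal_ne_zero (h : IsKummerSystem p ζ u α) (a : Fin f → ZMod p) :
    monomialVal α a ≠ 0 :=
  Finset.prod_ne_zero_iff.2 fun y _ => pow_ne_zero _ (h.ne_zero y)

theorem isIntegral (h : IsKummerSystem p ζ u α) (y : Fin f) : IsIntegral K (α y) :=
  IsIntegral.of_pow (Fact.out : p.Prime).pos (h.pow_eq y ▸ isIntegral_algebraMap)

theorem finiteDimensional (h : IsKummerSystem p ζ u α) : FiniteDimensional K F := by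
  have : FiniteDimensional K (adjoin K (Set.range α)) :=
    finiteDimensional_adjoin (by rintro _ ⟨y, rfl⟩; exact h.isIntegral y)
  rw [h.adjoin_eq_top] at this
  exact Module.Finite.equiv (topEquiv (F := K) (E := F)).toLinearEquiv

theorem isGalois [CharZero K] (h : IsKummerSystem p ζ u α) : IsGalois K F := by
  have := h.finiteDimensional
  have : Normal K F := normal_iff.2 fun x => ⟨IsIntegral.of_finite K x, by
    refine splits_of_mem_adjoin K F (S := Set.range α) ?_ (h.adjoin_eq_top ▸ mem_top)
    rintro _ ⟨y, rfl⟩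
    refine ⟨h.isIntegral y, ?_⟩
    have hp := (Fact.out : p.Prime)
    have hs : (map (algebraMap K F) (X ^ p - C (u y))).Splits := by
      rw [Polynomial.map_sub, Polynomial.map_pow, map_X, map_C]
      exact X_pow_sub_C_splits_of_isPrimitiveRoot h.isPrimitiveRoot_algebraMap (h.pow_eq y)
    refine hs.of_dvd ?_ (Polynomial.map_dvd _ (minpoly.dvd K _ ?_))
    · exact (Polynomial.map_ne_zero_iff (algebraMap K F).injective).2
        (monic_X_pow_sub_C _ hp.ne_zero).ne_zero
    · simp [h.pow_eq]⟩
  exact ⟨⟩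

theorem exists_monoidHom (h : IsKummerSystem p ζ u α) :
    ∃ χ : (F ≃ₐ[K] F) →* (Fin f → Multiplicative (ZMod p)),
      ∀ σ y, σ (α y) = algebraMap K F ζ ^ (χ σ y).toAdd.val * α y := by
  have hp := (Fact.out : p.Prime)
  have hζ := h.isPrimitiveRoot_algebraMap
  have hex : ∀ (σ : F ≃ₐ[K] F) y, ∃ k : ZMod p, σ (α y) = algebraMap K F ζ ^ k.val * α y := by
    intro σ y
    have h1 : (σ (α y) / α y) ^ p = 1 := by
      rw [div_pow, ← map_pow, h.pow_eq, AlgEquiv.commutes, ← h.pow_eq,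
        div_self (pow_ne_zero _ (h.ne_zero y))]
    obtain ⟨k, hk, hk1⟩ := hζ.eq_pow_of_pow_eq_one h1
    exact ⟨k, by rw [ZMod.val_cast_of_lt hk, hk1, div_mul_cancel₀ _ (h.ne_zero y)]⟩
  choose χ hχ using hex
  have hinj : ∀ {y} {k₁ k₂ : ZMod p}, algebraMap K F ζ ^ k₁.val * α y =
      algebraMap K F ζ ^ k₂.val * α y → k₁ = k₂ := fun {y k₁ k₂} hk =>
    ZMod.val_injective p (hζ.pow_inj (ZMod.val_lt _) (ZMod.val_lt _)
      (mul_right_cancel₀ (h.ne_zero y) hk))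
  refine ⟨MonoidHom.mk' (fun σ y => Multiplicative.ofAdd (χ σ y)) fun σ τ => ?_, hχ⟩
  funext y
  change Multiplicative.ofAdd (χ (σ * τ) y) = Multiplicative.ofAdd (χ σ y + χ τ y)
  congr 1
  refine hinj (y := y) ?_
  rw [← hχ, AlgEquiv.mul_apply, hχ τ, map_mul, map_pow, AlgEquiv.commutes, hχ σ, ← mul_assoc,
    ← pow_add, ZMod.val_add, ← pow_eq_pow_mod _ hζ.pow_eq_one, add_comm]

variable {χ : (F ≃ₐ[K] F) →* (Fin f → Multiplicative (ZMod p))}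

theorem apply_monomialVal
    (hχ : ∀ σ y, σ (α y) = algebraMap K F ζ ^ (χ σ y).toAdd.val * α y) (a : Fin f → ZMod p)
    (σ : F ≃ₐ[K] F) : σ (monomialVal α a) =
      algebraMap K F ζ ^ (∑ y, (χ σ y).toAdd.val * (a y).val) * monomialVal α a := by
  rw [monomialVal, map_prod, ← Finset.prod_pow_eq_pow_sum, ← Finset.prod_mul_distrib]
  refine Finset.prod_congr rfl fun y _ => ?_
  rw [map_pow, hχ, mul_pow, ← pow_mul]

theorem apply_monomialVal_eq_iff (h : IsKummerSystem p ζ u α)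
    (hχ : ∀ σ y, σ (α y) = algebraMap K F ζ ^ (χ σ y).toAdd.val * α y) (a : Fin f → ZMod p)
    (σ : F ≃ₐ[K] F) :
    σ (monomialVal α a) = monomialVal α a ↔ ∑ y, (χ σ y).toAdd * a y = 0 := by
  rw [apply_monomialVal hχ, mul_eq_right₀ (h.monomialVal_ne_zero a),
    h.isPrimitiveRoot_algebraMap.pow_eq_one_iff_dvd, ← ZMod.natCast_eq_zero_iff]
  simp

theorem injective (h : IsKummerSystem p ζ u α)
    (hχ : ∀ σ y, σ (α y) = algebraMap K F ζ ^ (χ σ y).toAdd.val * α y) :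
    Function.Injective χ := by
  refine (injective_iff_map_eq_one χ).2 fun σ hσ => ?_
  have h1 : adjoin K (Set.range α) ≤ fixedField (Subgroup.zpowers σ) := by
    refine adjoin_le_iff.2 ?_
    rintro _ ⟨y, rfl⟩
    have hy : σ • α y = α y := by
      change σ (α y) = α y
      rw [hχ, hσ]
      simp
    rintro ⟨τ, hτ⟩
    have h2 : Subgroup.zpowers σ ≤ MulAction.stabilizer (F ≃ₐ[K] F) (α y) := by
      rw [Subgroup.zpowers_le]
      exact hy
    exact h2 hτ
  rw [h.adjoin_eq_top] at h1
  exact AlgEquiv.ext fun x => h1 (mem_top : x ∈ ⊤) ⟨σ, Subgroup.mem_zpowers σ⟩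

theorem exists_monomialVal_of_map_ne_top (h : IsKummerSystem p ζ u α)
    (hχ : ∀ σ y, σ (α y) = algebraMap K F ζ ^ (χ σ y).toAdd.val * α y)
    {S : Subgroup (F ≃ₐ[K] F)} (hS : S.map χ ≠ ⊤) :
    ∃ a : Fin f → ZMod p, a ≠ 0 ∧ ∀ σ ∈ S, σ (monomialVal α a) = monomialVal α a := by
  set W : AddSubgroup (Fin f → ZMod p) :=
    { carrier := {w | (fun y => Multiplicative.ofAdd (w y)) ∈ S.map χ}
      zero_mem' := (S.map χ).one_mem
      add_mem' := fun ha hb => (S.map χ).mul_mem ha hb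
      neg_mem' := fun ha => (S.map χ).inv_mem ha } with hW
  have hne : AddSubgroup.toZModSubmodule p W ≠ ⊤ := fun htop => by
    refine hS ((Subgroup.eq_top_iff' _).2 fun g => ?_)
    have : (fun y => (g y).toAdd) ∈ AddSubgroup.toZModSubmodule p W := htop ▸ Submodule.mem_top
    exact this
  obtain ⟨φ, hφ, hle⟩ := Submodule.exists_le_ker_of_lt_top _ (lt_top_iff_ne_top.2 hne)
  refine ⟨fun y => φ fun j => if y = j then 1 else 0, fun h0 => hφ (LinearMap.ext fun w => ?_),
    fun σ hσ => ?_⟩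
  · rw [LinearMap.pi_apply_eq_sum_univ φ w]
    refine Finset.sum_eq_zero fun y _ => ?_
    rw [congrFun h0 y]
    simp
  · rw [h.apply_monomialVal_eq_iff hχ]
    have h1 : (fun y => (χ σ y).toAdd) ∈ AddSubgroup.toZModSubmodule p W :=
      Subgroup.mem_map_of_mem χ hσ
    have h2 := LinearMap.mem_ker.1 (hle h1)
    rwa [LinearMap.pi_apply_eq_sum_univ φ] at h2

theorem monomialVal_ne_algebraMap (h : IsKummerSystem p ζ u α) {a : Fin f → ZMod p} (ha : a ≠ 0)
    (b : K) : monomialVal α a ≠ algebraMap K F b := fun hb => by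
  refine h.pow_ne a ha b ((algebraMap K F).injective ?_)
  rw [← h.monomialVal_pow, hb, map_pow]

theorem surjective [CharZero K] (h : IsKummerSystem p ζ u α)
    (hχ : ∀ σ y, σ (α y) = algebraMap K F ζ ^ (χ σ y).toAdd.val * α y) :
    Function.Surjective χ := by
  rw [← MonoidHom.range_eq_top, MonoidHom.range_eq_map]
  by_contra hne
  obtain ⟨a, ha, hfix⟩ := h.exists_monomialVal_of_map_ne_top hχ hne
  have := h.isGalois
  have := h.finiteDimensional
  obtain ⟨b, hb⟩ := IntermediateField.mem_bot.1
    ((IsGalois.mem_bot_iff_fixed (F := K) _).2 fun σ => hfix σ (Subgroup.mem_top σ))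
  exact h.monomialVal_ne_algebraMap ha b hb.symm

theorem exists_monomialVal_of_ne_top (h : IsKummerSystem p ζ u α) [CharZero K]
    {S : Subgroup (F ≃ₐ[K] F)} (hS : S ≠ ⊤) :
    ∃ a : Fin f → ZMod p, a ≠ 0 ∧ ∀ σ ∈ S, σ (monomialVal α a) = monomialVal α a := by
  obtain ⟨χ, hχ⟩ := h.exists_monoidHom
  refine h.exists_monomialVal_of_map_ne_top hχ fun hmap => hS ?_
  refine Subgroup.map_injective (h.injective hχ) ?_
  rw [hmap, ← MonoidHom.range_eq_map, MonoidHom.range_eq_top.2 (h.surjective hχ)]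

theorem exists_monomialVal_apply_ne (h : IsKummerSystem p ζ u α) {τ : F ≃ₐ[K] F} (hτ : τ ≠ 1) :
    ∃ a : Fin f → ZMod p, a ≠ 0 ∧ τ (monomialVal α a) ≠ monomialVal α a := by
  obtain ⟨χ, hχ⟩ := h.exists_monoidHom
  obtain ⟨y, hy⟩ := Function.ne_iff.1 ((map_ne_one_iff χ (h.injective hχ)).2 hτ)
  refine ⟨Pi.single y 1, by simp, fun h1 => hy ?_⟩
  rw [h.apply_monomialVal_eq_iff hχ] at h1
  simpa [Pi.single_apply] using h1

theorem isElemAbelian [CharZero K] (h : IsKummerSystem p ζ u α) :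
    IsElemAbelian p (F ≃ₐ[K] F) := by
  obtain ⟨χ, hχ⟩ := h.exists_monoidHom
  exact ⟨f, ⟨MulEquiv.ofBijective χ ⟨h.injective hχ, h.surjective hχ⟩⟩⟩

theorem finrank_eq [CharZero K] (h : IsKummerSystem p ζ u α) : Module.finrank K F = p ^ f := by
  obtain ⟨χ, hχ⟩ := h.exists_monoidHom
  have := h.isGalois
  have := h.finiteDimensional
  rw [← IsGalois.card_aut_eq_finrank, Nat.card_congr (Equiv.ofBijective χ
    ⟨h.injective hχ, h.surjective hχ⟩), Nat.card_fun]
  simp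

theorem exists_apply_monomialVal (h : IsKummerSystem p ζ u α) (a : Fin f → ZMod p)
    (σ : F ≃ₐ[K] F) : ∃ k : ℕ, σ (monomialVal α a) = algebraMap K F ζ ^ k * monomialVal α a := by
  obtain ⟨χ, hχ⟩ := h.exists_monoidHom
  exact ⟨_, apply_monomialVal hχ a σ⟩

theorem finrank_adjoin_monomialVal (h : IsKummerSystem p ζ u α) {a : Fin f → ZMod p} (ha : a ≠ 0) :
    Module.finrank K K⟮monomialVal α a⟯ = p := by
  have hp := (Fact.out : p.Prime)
  have := h.finiteDimensional
  rw [adjoin.finrank (IsIntegral.of_finite K _), ← minpoly.eq_of_irreducible_of_monic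
    (X_pow_sub_C_irreducible_of_prime hp (h.pow_ne a ha)) ?_ (monic_X_pow_sub_C _ hp.ne_zero),
    natDegree_X_pow_sub_C]
  simp only [map_sub, map_pow, aeval_X, aeval_C]
  rw [h.monomialVal_pow, sub_self]

end IsKummerSystem

end Kummer

section Main

open IntermediateField

variable {p f : ℕ} {ζ : K} {vK : AddValuation K (WithTop ℤ)} {vF : AddValuation F (WithTop ℤ)}
  {eK eL t t' l : ℕ} {π : K} {c : Fin f → K} {α : Fin f → F}

theorem IsPadicValuation.map_natCast_prime [Fact p.Prime] [Algebra ℚ_[p] K]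
    (h : IsPadicValuation p vK eK) : vK (p : K) = ((eK : ℤ) : WithTop ℤ) := by
  have h1 := h.2.2 (p : ℚ_[p]) (by exact_mod_cast (Fact.out : p.Prime).ne_zero)
  simpa using h1

theorem not_dvd_of_coprime (hp : p.Prime) (ht : Nat.Coprime t p) (ht' : (p - 1) * t' = p * eK)
    (hl : t + l = t') : ¬ p ∣ l := by
  intro h
  have h1 : p ∣ t' := by
    refine (Nat.Coprime.dvd_of_dvd_mul_left ?_ ⟨eK, ht'⟩ : p ∣ t')
    rw [Nat.coprime_comm, Nat.coprime_self_sub_left hp.one_lt.le]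
    exact Nat.coprime_one_left p
  have h2 : p ∣ t := (Nat.dvd_add_left h).1 (hl ▸ h1)
  exact (Nat.Prime.coprime_iff_not_dvd hp).1 ht.symm h2

theorem isKummerSystem [Fact p.Prime] (hζ : IsPrimitiveRoot ζ p)
    (hpv : vK (p : K) = ((eK : ℤ) : WithTop ℤ)) (hπ : vK π = ((1 : ℤ) : WithTop ℤ))
    (hc : IsResidueBasis p vK c) (hpl : ¬ p ∣ l) (hlt : (p - 1) * l < p * eK)
    (hα : ∀ y, α y ^ p = algebraMap K F (1 + c y * π ^ l))
    (hgen : adjoin K (Set.range α) = ⊤) :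
    IsKummerSystem p ζ (fun y => 1 + c y * π ^ l) α := by
  refine ⟨hζ, hα, hgen, fun a ha b hb => hpl ?_⟩
  have hp := (Fact.out : p.Prime)
  have hl1 : 1 ≤ l := Nat.one_le_iff_ne_zero.2 (by rintro rfl; simp at hpl)
  have h1 := map_prod_one_add_sub_one vK hc hπ hl1 ha
  rw [← hb] at h1
  obtain ⟨m, -, hm⟩ := exists_map_sub_one_eq_of_pow vK hp hpv (by positivity) (by
    have := hp.one_lt.le
    zify [this] at hlt
    exact hlt) h1
  exact Int.natCast_dvd_natCast.1 ⟨m, hm.symm⟩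

/-- A nontrivial Kummer monomial is congruent to `1`, with difference of valuation
`eL * l / p`. -/
theorem IsKummerSystem.exists_map_monomialVal_sub_one [Fact p.Prime]
    (h : IsKummerSystem p ζ (fun y => 1 + c y * π ^ l) α) (hext : Extends vK vF eL)
    (hpv : vK (p : K) = ((eK : ℤ) : WithTop ℤ)) (hπ : vK π = ((1 : ℤ) : WithTop ℤ))
    (hc : IsResidueBasis p vK c) (hl1 : 1 ≤ l) (hlt : (p - 1) * l < p * eK)
    {a : Fin f → ZMod p} (ha : a ≠ 0) :
    ∃ b : ℤ, vF (monomialVal α a - 1) = b ∧ p * b = eL * l := by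
  have hp := (Fact.out : p.Prime)
  have h1 := hext.map_algebraMap_eq_coe (map_prod_one_add_sub_one vK hc hπ hl1 ha)
  rw [map_sub, map_one, ← h.monomialVal_pow] at h1
  have hpF : vF (p : F) = ((eL * eK : ℤ) : WithTop ℤ) := by
    simpa using hext.map_algebraMap_eq_coe hpv
  have heL := hext.1
  refine exists_map_sub_one_eq_of_pow vF hp hpF (by positivity) ?_ h1
  have := hp.one_lt.le
  zify [this] at hlt heL
  nlinarith

theorem IsKummerSystem.isJumpGenerator [Fact p.Prime]
    (h : IsKummerSystem p ζ (fun y => 1 + c y * π ^ l) α) {e' : ℕ} (hext : Extends vK vF (p * e'))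
    (hpv : vK (p : K) = ((eK : ℤ) : WithTop ℤ)) (hπ : vK π = ((1 : ℤ) : WithTop ℤ))
    (hc : IsResidueBasis p vK c) (hl1 : 1 ≤ l) (hlt : (p - 1) * l < p * eK)
    (ht' : (p - 1) * (t + l) = p * eK) {a : Fin f → ZMod p} (ha : a ≠ 0) :
    IsJumpGenerator K vF p e' l t (monomialVal α a - 1) := by
  have hp := (Fact.out : p.Prime)
  have he' : 0 < e' := Nat.pos_of_mul_pos_left hext.1
  have hp0 : (p : ℤ) ≠ 0 := by exact_mod_cast hp.ne_zero
  obtain ⟨b, hb, hpb⟩ := h.exists_map_monomialVal_sub_one hext hpv hπ hc hl1 hlt ha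
  have hb' : b = e' * l := by
    refine mul_left_cancel₀ hp0 ?_
    rw [hpb]
    push_cast
    ring
  subst hb'
  have hv0 : vF (monomialVal α a) = 0 := by
    have h1 : vF 1 < vF (monomialVal α a - 1) := by
      rw [hb, vF.map_one]
      exact_mod_cast (by positivity : (0 : ℤ) < e' * l)
    have h2 := vF.map_add_eq_of_lt_right h1
    rwa [sub_add_cancel, vF.map_one] at h2
  refine ⟨?_, hb, fun σ hσ => ?_⟩
  · have h1 : K⟮monomialVal α a - 1⟯ = K⟮monomialVal α a⟯ := by
      refine le_antisymm (adjoin_simple_le_iff.2 ?_) (adjoin_simple_le_iff.2 ?_)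
      · exact sub_mem (mem_adjoin_simple_self K _) (one_mem _)
      · have := add_mem (mem_adjoin_simple_self K (monomialVal α a - 1)) (one_mem _)
        rwa [sub_add_cancel] at this
    rw [h1]
    exact h.finrank_adjoin_monomialVal ha
  · obtain ⟨k, hk⟩ := h.exists_apply_monomialVal a σ
    obtain ⟨w, hw, hζw⟩ := map_pow_sub_one_of_isPrimitiveRoot vK hp hpv h.isPrimitiveRoot
    have hpk : ¬ p ∣ k := fun hdvd => hσ (by
      rw [map_sub, map_one, hk, (h.isPrimitiveRoot_algebraMap.pow_eq_one_iff_dvd k).2 hdvd,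
        one_mul])
    have h1 : σ (monomialVal α a - 1) - (monomialVal α a - 1) =
        algebraMap K F (ζ ^ k - 1) * monomialVal α a := by
      rw [map_sub, map_one, hk, map_sub, map_pow, map_one]
      ring
    rw [h1, vF.map_mul, hv0, add_zero, hext.map_algebraMap_eq_coe (hζw k hpk)]
    congr 1
    have h2 : ((p : ℤ) - 1) * (t + l) = p * eK := by
      have := hp.one_lt.le
      zify [this] at ht'
      exact ht'
    have h3 : (t + l : ℤ) = p * w := by
      have h4 : (p : ℤ) - 1 ≠ 0 := sub_ne_zero.2 (by exact_mod_cast hp.one_lt.ne')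
      refine mul_left_cancel₀ h4 ?_
      rw [h2, ← hw]
      ring
    rw [add_comm (l : ℤ), h3]
    push_cast
    ring

theorem isUpperJump_iff_of_isKummerSystem [Fact p.Prime] [CharZero K] (hf : 0 < f)
    (h : IsKummerSystem p ζ (fun y => 1 + c y * π ^ l) α) (hext : Extends vK vF eL)
    (hvF : IsNormalized vF) (hGal : GalInvariant K vF) (heK : 0 < eK)
    (hpv : vK (p : K) = ((eK : ℤ) : WithTop ℤ)) (hπ : vK π = ((1 : ℤ) : WithTop ℤ))
    (hc : IsResidueBasis p vK c) (hpl : ¬ p ∣ l) (hlt : (p - 1) * l < p * eK)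
    (ht0 : 1 ≤ t) (ht' : (p - 1) * (t + l) = p * eK) (s : ℤ) :
    IsUpperJump vF hGal s ↔ s = t := by
  have hp := (Fact.out : p.Prime)
  have := h.finiteDimensional
  have := h.isGalois
  have hl1 : 1 ≤ l := Nat.one_le_iff_ne_zero.2 (by rintro rfl; simp at hpl)
  have ha : (Pi.single ⟨0, hf⟩ 1 : Fin f → ZMod p) ≠ 0 := by simp
  obtain ⟨b, -, hb⟩ := h.exists_map_monomialVal_sub_one hext hpv hπ hc hl1 hlt ha
  obtain ⟨e', rfl⟩ : p ∣ eL := by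
    have h1 : p ∣ eL * l := Int.natCast_dvd_natCast.1 ⟨b, by rw [hb]; push_cast; rfl⟩
    exact (hp.dvd_mul.1 h1).resolve_right hpl
  have hjump := fun (a : Fin f → ZMod p) (ha : a ≠ 0) =>
    h.isJumpGenerator hext hpv hπ hc hl1 hlt ht' ha
  have hpv1 : (1 : WithTop ℤ) ≤ vK (p : K) := by
    rw [hpv]
    exact_mod_cast heK
  obtain ⟨htop, hbot⟩ := lowerRG_of_isJumpGenerator hext hGal hvF hp hpv1 hc
    ⟨f, h.finrank_eq⟩ rfl hpl ht0 hπ (fun S hS => by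
      obtain ⟨a, ha, hfix⟩ := h.exists_monomialVal_of_ne_top hS
      refine ⟨_, hjump a ha, fun σ hσ => ?_⟩
      have h1 : K⟮monomialVal α a - 1⟯ ≤ fixedField S := adjoin_simple_le_iff.2 (by
        rintro ⟨τ, hτ⟩
        change τ (monomialVal α a - 1) = _
        rw [map_sub, hfix τ hτ, map_one])
      exact (IntermediateField.le_iff_le S _).1 h1 hσ) (fun τ hτ => by
      obtain ⟨a, ha, hne⟩ := h.exists_monomialVal_apply_ne hτ
      refine ⟨_, hjump a ha, fun h1 => hne ?_⟩
      rwa [map_sub, map_one, sub_left_inj] at h1)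
  have : Nontrivial (F ≃ₐ[K] F) := by
    rw [← Finite.one_lt_card_iff_nontrivial, IsGalois.card_aut_eq_finrank, h.finrank_eq]
    exact Nat.one_lt_pow hf.ne' hp.one_lt
  exact isUpperJump_iff_eq htop hbot s

end Main

/-- Proposition 15, first case. If `ζ_p ∈ K`, `t ∈ I` and
`l = p·e_K/(p-1) - t`, then `L_t = K((1 + c_y π^l)^{1/p} : y = 1,…,f_K)` is an elementary
abelian `p`-extension of degree `p^{f_K}` with exactly one upper ramification jump,
equal to `t`. -/
theorem statement_13
    (p : ℕ) [Fact p.Prime]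
    (K : Type*) [Field K] [Algebra ℚ_[p] K] [FiniteDimensional ℚ_[p] K]
    (vK : AddValuation K (WithTop ℤ)) (eK fK : ℕ)
    (hvK : IsPadicValuation p vK eK)
    (hfK : eK * fK = Module.finrank ℚ_[p] K)
    (hζ : ∃ ζ : K, IsPrimitiveRoot ζ p)
    (π : K) (hπ : vK π = ((1 : ℤ) : WithTop ℤ))
    (c : Fin fK → K) (hc : IsResidueBasis p vK c)
    (t : ℕ) (ht : 1 ≤ t ∧ (p - 1) * t < p * eK ∧ Nat.Coprime t p)
    (t' l : ℕ) (ht' : (p - 1) * t' = p * eK) (hl : t + l = t')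
    (Ω : Type*) [Field Ω] [Algebra K Ω] [IsAlgClosure K Ω]
    (α : Fin fK → Ω) (hα : ∀ y, (α y) ^ p = algebraMap K Ω (1 + c y * π ^ l))
    (vL : AddValuation ↥(IntermediateField.adjoin K (Set.range α)) (WithTop ℤ)) (eL : ℕ)
    (hvL : IsNormalized vL) (hext : Extends vK vL eL) (hGal : GalInvariant K vL) :
    IsGalois K ↥(IntermediateField.adjoin K (Set.range α)) ∧
    IsElemAbelian p (↥(IntermediateField.adjoin K (Set.range α)) ≃ₐ[K]
      ↥(IntermediateField.adjoin K (Set.range α))) ∧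
    Module.finrank K ↥(IntermediateField.adjoin K (Set.range α)) = p ^ fK ∧
    (∀ s : ℤ, IsUpperJump vL hGal s ↔ s = (t : ℤ)) := by
  subst hl
  obtain ⟨ζ, hζ⟩ := hζ
  have hp := (Fact.out : p.Prime)
  have : CharZero K := charZero_of_injective_algebraMap (algebraMap ℚ_[p] K).injective
  have hpv := hvK.map_natCast_prime
  have hfK0 : 0 < fK := Nat.pos_of_mul_pos_left (hfK ▸ Module.finrank_pos)
  have hpl := not_dvd_of_coprime hp ht.2.2 ht' rfl
  have hlt : (p - 1) * l < p * eK := by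
    rw [← ht']
    exact Nat.mul_lt_mul_of_pos_left (by lia) (Nat.sub_pos_of_lt hp.one_lt)
  set L := IntermediateField.adjoin K (Set.range α)
  have hαL : ∀ y, α y ∈ L := fun y => IntermediateField.subset_adjoin K _ ⟨y, rfl⟩
  have hgen : IntermediateField.adjoin K (Set.range fun y => (⟨α y, hαL y⟩ : L)) = ⊤ := by
    refine IntermediateField.lift_injective L ?_
    rw [IntermediateField.lift_adjoin, IntermediateField.lift_top, ← Set.range_comp]
    rfl
  have h := isKummerSystem hζ hpv hπ hc hpl hlt (α := fun y => (⟨α y, hαL y⟩ : L))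
    (fun y => Subtype.ext (hα y)) hgen
  exact ⟨h.isGalois, h.isElemAbelian, h.finrank_eq, isUpperJump_iff_of_isKummerSystem hfK0 h hext
    hvL hGal hvK.2.1 hpv hπ hc hpl hlt ht.1 ht'⟩

end PaperRam
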